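/- (Interior estimates for σ-harmonic functions.) Let n ≥ 1, σ ∈ (0,1), r > 0, and let u ∈ L_σ(ℝⁿ) satisfy ∫_{ℝⁿ} u(x)·((−Δ)^σφ)(x) dx = 0 for every φ ∈ C_c^∞(B_{2r}(0)). Then u agrees almost everywhere on B_{2r}(0) with a function ũ ∈ C^∞(B_{2r}(0)), and for every k ∈ ℕ there exists a constant C = C(n,σ,k) > 0, independent of u and r, such that sup_{x ∈ B_r(0)} |∇^k ũ(x)| ≤ (C/r^k)·( r^{2σ} ∫_{ℝⁿ∖B_{2r}(0)} |u(x)|/|x|^{n+2σ} dx + r^{−n} ∫_{B_{2r}(0)} |u(x)| dx ). -/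

import Mathlib

open MeasureTheory Real Filter

noncomputable section

/-- The normalizing constant `c_{n,σ} = 4^σ Γ(n/2+σ)/(π^{n/2}|Γ(−σ)|)` of the fractional
Laplacian. -/
def fracConst (n : ℕ) (σ : ℝ) : ℝ :=
  (4 : ℝ) ^ σ * Real.Gamma ((n : ℝ) / 2 + σ) / (Real.pi ^ ((n : ℝ) / 2) * |Real.Gamma (-σ)|)

/-- The fractional Laplacian `(−Δ)^σ φ` of a function on ℝⁿ, defined as a principal value:
`c_{n,σ} lim_{ε→0⁺} ∫_{|x−y|>ε} (φ(x)−φ(y))/|x−y|^{n+2σ} dy`. -/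
def fracLap (n : ℕ) (σ : ℝ) (φ : EuclideanSpace ℝ (Fin n) → ℝ)
    (x : EuclideanSpace ℝ (Fin n)) : ℝ :=
  fracConst n σ * limUnder (nhdsWithin (0:ℝ) (Set.Ioi 0)) fun ε =>
    ∫ y in {y : EuclideanSpace ℝ (Fin n) | ε < ‖x - y‖},
      (φ x - φ y) / ‖x - y‖ ^ ((n : ℝ) + 2 * σ)

/-- `u ∈ L_σ(ℝⁿ)`. -/
def MemLσ (n : ℕ) (σ : ℝ) (u : EuclideanSpace ℝ (Fin n) → ℝ) : Prop :=
  LocallyIntegrable u volume ∧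
    Integrable (fun x => |u x| / (1 + ‖x‖ ^ ((n : ℝ) + 2 * σ))) volume

end

open Topology Module

section ParametricIntegral

variable {α E G : Type*} [MeasurableSpace α] {μ : Measure α} [NormedAddCommGroup E]
  [NormedSpace ℝ E] [NormedAddCommGroup G] [NormedSpace ℝ G] [CompleteSpace G]

theorem hasFDerivAt_integral_of_linearIsometryEquiv {A B : Type*} [NormedAddCommGroup A]
    [NormedSpace ℝ A] [CompleteSpace A] [NormedAddCommGroup B] [NormedSpace ℝ B] [CompleteSpace B]
    (L : B ≃ₗᵢ[ℝ] (E →L[ℝ] A)) {f : E → α → A} {f' : E → α → B} {b : α → ℝ} {x : E}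
    (hf : ∀ y, AEStronglyMeasurable (f y) μ) (hint : Integrable (f x) μ)
    (hf' : AEStronglyMeasurable (f' x) μ) (hb : Integrable b μ)
    (hle : ∀ᵐ a ∂μ, ∀ y ∈ Metric.ball x 1, ‖f' y a‖ ≤ b a)
    (hd : ∀ a y, HasFDerivAt (f · a) (L (f' y a)) y) :
    HasFDerivAt (fun y => ∫ a, f y a ∂μ) (L (∫ a, f' x a ∂μ)) x := by
  have key : HasFDerivAt (fun y => ∫ a, f y a ∂μ) (∫ a, L (f' x a) ∂μ) x :=
    hasFDerivAt_integral_of_dominated_of_fderiv_le (𝕜 := ℝ) (bound := b)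
      (F' := fun y a => L (f' y a)) (Metric.ball_mem_nhds x one_pos)
      (Eventually.of_forall hf) hint (L.continuous.comp_aestronglyMeasurable hf')
      (hle.mono fun a ha y hy => (L.norm_map _).trans_le (ha y hy)) hb
      (Eventually.of_forall fun a y _ => hd a y)
  have e : ∫ a, L (f' x a) ∂μ = L (∫ a, f' x a ∂μ) :=
    L.toContinuousLinearEquiv.integral_comp_comm (f' x)
  rwa [← e]

/-- Differentiation under the integral sign to all orders. -/
theorem hasFTaylorSeriesUpTo_integral {f : E → α → G}
    (hf : ∀ a, ContDiff ℝ (⊤ : ℕ∞) (f · a))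
    (hmeas : ∀ k x, AEStronglyMeasurable (fun a => iteratedFDeriv ℝ k (f · a) x) μ)
    (hbd : ∀ (k : ℕ) (x₀ : E), ∃ bound : α → ℝ, Integrable bound μ ∧
      ∀ᵐ a ∂μ, ∀ x ∈ Metric.ball x₀ 1, ‖iteratedFDeriv ℝ k (f · a) x‖ ≤ bound a) :
    HasFTaylorSeriesUpTo (⊤ : ℕ∞) (fun x => ∫ a, f x a ∂μ)
      (fun x k => ∫ a, iteratedFDeriv ℝ k (f · a) x ∂μ) := by
  have hint : ∀ k x, Integrable (fun a => iteratedFDeriv ℝ k (f · a) x) μ := by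
    intro k x
    obtain ⟨b, hb, hle⟩ := hbd k x
    exact hb.mono' (hmeas k x) (hle.mono fun a ha => ha x (Metric.mem_ball_self one_pos))
  have hder : ∀ (m : ℕ) (x : E), HasFDerivAt (fun y => ∫ a, iteratedFDeriv ℝ m (f · a) y ∂μ)
      (∫ a, iteratedFDeriv ℝ (m + 1) (f · a) x ∂μ).curryLeft x := by
    intro m x
    obtain ⟨b, hb, hle⟩ := hbd (m + 1) x
    refine hasFDerivAt_integral_of_linearIsometryEquiv
      (continuousMultilinearCurryLeftEquiv ℝ (fun _ : Fin (m + 1) => E) G) (hmeas m) (hint m x)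
      (hmeas (m + 1) x) hb hle fun a y => ?_
    have := ((hf a).contDiffAt.differentiableAt_iteratedFDeriv (m := m) (x := y)
      (by exact_mod_cast ENat.natCast_lt_top m)).hasFDerivAt
    rwa [fderiv_iteratedFDeriv] at this
  refine ⟨fun x => ?_, fun m _ x => hder m x, fun m _ => ?_⟩
  · rw [ContinuousMultilinearMap.curry0, ContinuousMultilinearMap.integral_apply (hint 0 x)]
    simp
  · exact continuous_iff_continuousAt.2 fun x => (hder m x).continuousAt

end ParametricIntegral

section SecondDifference

variable {E G : Type*} [NormedAddCommGroup E] [NormedSpace ℝ E] [NormedAddCommGroup G]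
  [NormedSpace ℝ G]

/-- The symmetric second difference `g(x) - (g(x+y) + g(x-y))/2`. -/
noncomputable def secondDiff (g : E → G) (x y : E) : G :=
  g x - (1 / 2 : ℝ) • (g (x + y) + g (x - y))

omit [NormedSpace ℝ E] in
theorem norm_secondDiff_le {g : E → G} {A : ℝ} (hA : ∀ x, ‖g x‖ ≤ A) (x y : E) :
    ‖secondDiff g x y‖ ≤ 2 * A := by
  have h1 := norm_sub_le (g x) ((1 / 2 : ℝ) • (g (x + y) + g (x - y)))
  have h2 := norm_add_le (g (x + y)) (g (x - y))
  rw [norm_smul] at h1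
  norm_num at h1
  unfold secondDiff
  norm_num
  linarith [hA x, hA (x + y), hA (x - y)]

theorem norm_sub_sub_fderiv_le {g : E → G} (hd : Differentiable ℝ g) {B : NNReal}
    (hB : LipschitzWith B (fderiv ℝ g)) (x y : E) :
    ‖g (x + y) - g x - fderiv ℝ g x y‖ ≤ B * ‖y‖ ^ 2 := by
  have hl : ∀ z, ‖fderiv ℝ g z - fderiv ℝ g x‖ ≤ B * ‖z - x‖ := fun z => hB.norm_sub_le z x
  have := (convex_closedBall x ‖y‖).norm_image_sub_le_of_norm_fderiv_le' (𝕜 := ℝ) (f := g)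
    (φ := fderiv ℝ g x) (C := B * ‖y‖) (x := x) (y := x + y) (fun z _ => hd z)
    (fun z hz => (hl z).trans
      (mul_le_mul_of_nonneg_left (by simpa [dist_eq_norm] using hz) B.2))
    (Metric.mem_closedBall_self (norm_nonneg _)) (by simp)
  simp only [add_sub_cancel_left] at this
  exact this.trans_eq (by ring)

theorem norm_secondDiff_le_sq {g : E → G} (hd : Differentiable ℝ g) {B : NNReal}
    (hB : LipschitzWith B (fderiv ℝ g)) (x y : E) :
    ‖secondDiff g x y‖ ≤ B * ‖y‖ ^ 2 := by
  have h1 := norm_sub_sub_fderiv_le hd hB x y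
  have h2 := norm_sub_sub_fderiv_le hd hB x (-y)
  have h3 : secondDiff g x y = -((1 / 2 : ℝ) • ((g (x + y) - g x - fderiv ℝ g x y) +
      (g (x + -y) - g x - fderiv ℝ g x (-y)))) := by
    simp only [secondDiff, map_neg, ← sub_eq_add_neg]
    module
  rw [h3, norm_neg, norm_smul]
  have h4 := norm_add_le (g (x + y) - g x - fderiv ℝ g x y)
    (g (x + -y) - g x - fderiv ℝ g x (-y))
  rw [norm_neg] at h2
  rw [Real.norm_of_nonneg (by norm_num : (0 : ℝ) ≤ 1 / 2)]
  linarith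

theorem exists_norm_secondDiff_le {g : E → G} (hg : ContDiff ℝ 2 g) (hs : HasCompactSupport g) :
    ∃ A : ℝ, 0 ≤ A ∧ ∀ x y, ‖secondDiff g x y‖ ≤ A * min 1 (‖y‖ ^ 2) := by
  obtain ⟨A, hA⟩ := hs.exists_bound_of_continuous hg.continuous
  obtain ⟨B, hB⟩ := (hg.fderiv_right (m := 1) (by norm_num)).lipschitzWith_of_hasCompactSupport
    (hs.fderiv ℝ) one_ne_zero
  have hA0 : 0 ≤ A := (norm_nonneg _).trans (hA 0)
  refine ⟨2 * A + B, by positivity, fun x y => ?_⟩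
  have h1 := norm_secondDiff_le hA x y
  have h2 := norm_secondDiff_le_sq (hg.differentiable (by norm_num)) hB x y
  have hB0 : (0 : ℝ) ≤ B := B.2
  rcases min_cases (1 : ℝ) (‖y‖ ^ 2) with h | h <;> rw [h.1]
  · linarith
  · nlinarith [sq_nonneg ‖y‖]

theorem iteratedFDeriv_secondDiff {g : E → G} (hg : ContDiff ℝ (⊤ : ℕ∞) g) (c : ℝ) (k : ℕ)
    (x y : E) :
    iteratedFDeriv ℝ k (fun x => c • secondDiff g x y) x =
      c • secondDiff (iteratedFDeriv ℝ k g) x y := by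
  have hk : ContDiff ℝ k g := hg.of_le (by exact_mod_cast le_top)
  have h1 : ContDiff ℝ k (fun x => g (x + y)) := hk.comp (contDiff_id.add contDiff_const)
  have h2 : ContDiff ℝ k (fun x => g (x - y)) := hk.comp (contDiff_id.sub contDiff_const)
  have h3 : ContDiff ℝ k (fun x => g (x + y) + g (x - y)) := h1.add h2
  simp only [secondDiff]
  rw [iteratedFDeriv_const_smul_apply' (hk.sub (h3.const_smul (1 / 2 : ℝ))).contDiffAt,
    fun_iteratedFDeriv_sub_apply hk.contDiffAt (h3.const_smul (1 / 2 : ℝ)).contDiffAt,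
    iteratedFDeriv_const_smul_apply' h3.contDiffAt,
    fun_iteratedFDeriv_add_apply h1.contDiffAt h2.contDiffAt, iteratedFDeriv_comp_add_right,
    iteratedFDeriv_comp_sub]

end SecondDifference

theorem le_one_add_rpow_of_le {p f A B R t : ℝ} (ht : 0 ≤ t) (hp : 0 ≤ p) (hA : f ≤ A)
    (hA0 : 0 ≤ A) (hB0 : 0 ≤ B) (hR : 1 ≤ R) (hB : R ≤ t → f ≤ B * t ^ (-p)) :
    f ≤ (A * (1 + R) ^ p + B * 2 ^ p) * (1 + t) ^ (-p) := by
  have hx1 : 0 < 1 + t := by positivity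
  rw [rpow_neg hx1.le, ← div_eq_mul_inv, le_div_iff₀ (by positivity)]
  have hR0 : 0 ≤ R := zero_le_one.trans hR
  rcases le_total R t with h | h
  · have hx0 : 0 < t := by linarith
    have h1 : (1 + t) ^ p ≤ (2 * t) ^ p := rpow_le_rpow hx1.le (by linarith) hp
    rw [mul_rpow zero_le_two hx0.le] at h1
    calc f * (1 + t) ^ p ≤ B * t ^ (-p) * (1 + t) ^ p := by gcongr; exact hB h
      _ ≤ B * t ^ (-p) * (2 ^ p * t ^ p) := by gcongr
      _ = B * 2 ^ p * (t ^ (-p) * t ^ p) := by ring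
      _ = B * 2 ^ p := by rw [← rpow_add hx0]; simp
      _ ≤ _ := by have : 0 ≤ A * (1 + R) ^ p := by positivity
                  linarith
  · calc f * (1 + t) ^ p ≤ A * (1 + R) ^ p := by gcongr
      _ ≤ _ := by have : 0 ≤ B * 2 ^ p := by positivity
                  linarith

section NonlocalOp

variable {E G : Type*} [NormedAddCommGroup E] [InnerProductSpace ℝ E] [FiniteDimensional ℝ E]
  [MeasurableSpace E] [BorelSpace E] [NormedAddCommGroup G] [NormedSpace ℝ G] {p : ℝ}

theorem integrable_min_one_sq_mul_rpow [Nontrivial E] (hp : (finrank ℝ E : ℝ) < p)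
    (hp' : p < finrank ℝ E + 2) :
    Integrable (fun y : E => min 1 (‖y‖ ^ 2) * ‖y‖ ^ (-p)) := by
  have hd : (1 : ℝ) ≤ finrank ℝ E := by exact_mod_cast finrank_pos (R := ℝ) (M := E)
  have hcast : ∀ y : ℝ, y ^ (finrank ℝ E - 1) = y ^ ((finrank ℝ E : ℝ) - 1) := fun y => by
    rw [← rpow_natCast, Nat.cast_sub (finrank_pos (R := ℝ) (M := E)), Nat.cast_one]
  rw [integrable_fun_norm_addHaar volume (f := fun t : ℝ => min 1 (t ^ 2) * t ^ (-p)),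
    ← Set.Ioc_union_Ioi_eq_Ioi (zero_le_one (α := ℝ))]
  refine IntegrableOn.union ?_ ?_
  · have h : IntegrableOn (fun y : ℝ => y ^ ((finrank ℝ E : ℝ) - 1 + 2 - p)) (Set.Ioc 0 1) :=
      (intervalIntegrable_iff_integrableOn_Ioc_of_le zero_le_one).1
        (intervalIntegral.intervalIntegrable_rpow' (by linarith))
    refine h.congr_fun (fun y hy => ?_) measurableSet_Ioc
    have h1 : y ^ 2 ≤ 1 := pow_le_one₀ hy.1.le hy.2
    simp only [smul_eq_mul]
    rw [min_eq_right h1, hcast, ← rpow_natCast y 2, ← rpow_add hy.1, ← rpow_add hy.1]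
    congr 1
    push_cast
    ring
  · have h : IntegrableOn (fun y : ℝ => y ^ ((finrank ℝ E : ℝ) - 1 - p)) (Set.Ioi 1) :=
      integrableOn_Ioi_rpow_of_lt (by linarith) one_pos
    refine h.congr_fun (fun y hy => ?_) measurableSet_Ioi
    have hy1 : (1 : ℝ) < y := hy
    have hy0 : 0 < y := one_pos.trans hy1
    simp only [smul_eq_mul]
    rw [min_eq_left (one_le_pow₀ hy1.le), one_mul, hcast, ← rpow_add hy0]
    congr 1

theorem integrableOn_norm_rpow_neg [Nontrivial E] (hp : (finrank ℝ E : ℝ) < p)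
    (hp' : p < finrank ℝ E + 2) {ε : ℝ} (hε : 0 < ε) :
    IntegrableOn (fun y : E => ‖y‖ ^ (-p)) {y : E | ε < ‖y‖} := by
  have hS : MeasurableSet {y : E | ε < ‖y‖} := measurableSet_lt measurable_const measurable_norm
  have hm : (0 : ℝ) < min 1 (ε ^ 2) := lt_min one_pos (by positivity)
  refine (((integrable_min_one_sq_mul_rpow hp hp').const_mul (min 1 (ε ^ 2))⁻¹).integrableOn).mono'
    (by fun_prop : Measurable fun y : E => ‖y‖ ^ (-p)).aestronglyMeasurable
    ((ae_restrict_iff' hS).2 (Eventually.of_forall fun y hy => ?_))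
  have hy' : ε < ‖y‖ := hy
  rw [Real.norm_of_nonneg (by positivity), ← mul_assoc]
  refine le_mul_of_one_le_left (by positivity) ?_
  rw [inv_mul_eq_div, one_le_div hm]
  exact min_le_min le_rfl (by gcongr)

/-- The operator `g ↦ ∫ (g(x) - (g(x+y) + g(x-y))/2) |y|^{-p} dy`, a multiple of a fractional
Laplacian. -/
noncomputable def nonlocalOp (p : ℝ) (g : E → G) (x : E) : G :=
  ∫ y : E, ‖y‖ ^ (-p) • secondDiff g x y

theorem integrable_nonlocalOp [Nontrivial E] (hp : (finrank ℝ E : ℝ) < p)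
    (hp' : p < finrank ℝ E + 2) {g : E → G} (hg : ContDiff ℝ 2 g) (hs : HasCompactSupport g)
    (x : E) : Integrable (fun y : E => ‖y‖ ^ (-p) • secondDiff g x y) := by
  obtain ⟨A, hA0, hA⟩ := exists_norm_secondDiff_le hg hs
  refine ((integrable_min_one_sq_mul_rpow hp hp').const_mul A).mono' ?_
    (Eventually.of_forall fun y => ?_)
  · have := hg.continuous
    have h2 : Continuous fun y => secondDiff g x y := by unfold secondDiff; fun_prop
    exact (by fun_prop : Measurable fun y : E => ‖y‖ ^ (-p)).aestronglyMeasurable.smul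
      h2.aestronglyMeasurable
  · rw [norm_smul, Real.norm_of_nonneg (by positivity)]
    calc _ ≤ ‖y‖ ^ (-p) * (A * min 1 (‖y‖ ^ 2)) := by gcongr; exact hA x y
      _ = _ := by ring

theorem hasFTaylorSeriesUpTo_nonlocalOp [Nontrivial E] [CompleteSpace G]
    (hp : (finrank ℝ E : ℝ) < p) (hp' : p < finrank ℝ E + 2) {g : E → G}
    (hg : ContDiff ℝ (⊤ : ℕ∞) g) (hs : HasCompactSupport g) :
    HasFTaylorSeriesUpTo (⊤ : ℕ∞) (nonlocalOp p g)
      (fun x k => nonlocalOp p (iteratedFDeriv ℝ k g) x) := by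
  have hgk : ∀ k : ℕ, ContDiff ℝ 2 (iteratedFDeriv ℝ k g) := fun k =>
    contDiff_infty.1 (hg.iteratedFDeriv_right (m := (⊤ : ℕ∞)) (by exact_mod_cast le_top)) 2
  have hsk : ∀ k : ℕ, HasCompactSupport (iteratedFDeriv ℝ k g) := fun k => hs.iteratedFDeriv k
  have h := hasFTaylorSeriesUpTo_integral (μ := (volume : Measure E))
    (f := fun x y => ‖y‖ ^ (-p) • secondDiff g x y) (fun y => ?_) (fun k x => ?_) (fun k x => ?_)
  · simp only [iteratedFDeriv_secondDiff hg] at h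
    exact h
  · unfold secondDiff
    fun_prop
  · simp only [iteratedFDeriv_secondDiff hg]
    exact (integrable_nonlocalOp hp hp' (hgk k) (hsk k) x).aestronglyMeasurable
  · obtain ⟨A, hA0, hA⟩ := exists_norm_secondDiff_le (hgk k) (hsk k)
    refine ⟨_, (integrable_min_one_sq_mul_rpow hp hp').const_mul A,
      Eventually.of_forall fun y z _ => ?_⟩
    rw [iteratedFDeriv_secondDiff hg, norm_smul, Real.norm_of_nonneg (by positivity)]
    calc _ ≤ ‖y‖ ^ (-p) * (A * min 1 (‖y‖ ^ 2)) := by gcongr; exact hA z y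
      _ = _ := by ring

theorem exists_norm_nonlocalOp_le [Nontrivial E] (hp : (finrank ℝ E : ℝ) < p)
    (hp' : p < finrank ℝ E + 2) {g : E → G} (hg : ContDiff ℝ 2 g)
    (hs : tsupport g ⊆ Metric.closedBall 0 1) :
    ∃ C : ℝ, 0 ≤ C ∧ ∀ x, ‖nonlocalOp p g x‖ ≤ C * (1 + ‖x‖) ^ (-p) := by
  have hp0 : 0 < p := (Nat.cast_nonneg _).trans_lt hp
  have hcs : HasCompactSupport g := HasCompactSupport.of_support_subset_isCompact
    (isCompact_closedBall 0 1) ((subset_tsupport g).trans hs)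
  have hz : ∀ x, 1 < ‖x‖ → g x = 0 := fun x hx => by
    by_contra h
    have := hs (subset_tsupport g h)
    rw [mem_closedBall_zero_iff] at this
    linarith
  obtain ⟨A, hA0, hA⟩ := exists_norm_secondDiff_le hg hcs
  have hgi : Integrable g := hg.continuous.integrable_of_hasCompactSupport hcs
  set I := ∫ y : E, min 1 (‖y‖ ^ 2) * ‖y‖ ^ (-p) with hI
  have hI0 : 0 ≤ I := integral_nonneg fun y => by positivity
  set J := ∫ y, ‖g y‖ with hJ
  have hJ0 : 0 ≤ J := integral_nonneg fun y => by positivity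
  refine ⟨_, ?_, fun x => le_one_add_rpow_of_le (norm_nonneg x) hp0.le (A := A * I) (B := 2 ^ p * J) (R := 2)
    ?_ (by positivity) (by positivity) one_le_two fun hx => ?_⟩
  · positivity
  · rw [hI, ← integral_const_mul]
    refine norm_integral_le_of_norm_le ((integrable_min_one_sq_mul_rpow hp hp').const_mul A)
      (Eventually.of_forall fun y => ?_)
    rw [norm_smul, Real.norm_of_nonneg (by positivity)]
    calc _ ≤ ‖y‖ ^ (-p) * (A * min 1 (‖y‖ ^ 2)) := by gcongr; exact hA x y
      _ = _ := by ring
  · have hx0 : 0 < ‖x‖ := by linarith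
    have hle : ∀ y : E, ‖‖y‖ ^ (-p) • secondDiff g x y‖ ≤
        2 ^ p * ‖x‖ ^ (-p) * ((1 / 2) * (‖g (x + y)‖ + ‖g (x - y)‖)) := by
      intro y
      rw [norm_smul, Real.norm_of_nonneg (by positivity), secondDiff, hz x (by linarith), zero_sub,
        norm_neg, norm_smul, Real.norm_of_nonneg (by norm_num : (0 : ℝ) ≤ 1 / 2)]
      rcases le_or_gt (‖x‖ / 2) ‖y‖ with h | h
      · have : ‖y‖ ^ (-p) ≤ 2 ^ p * ‖x‖ ^ (-p) := by
          calc ‖y‖ ^ (-p) ≤ (‖x‖ / 2) ^ (-p) :=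
                rpow_le_rpow_of_nonpos (by positivity) h (by linarith)
            _ = _ := by
              rw [div_rpow hx0.le zero_le_two, rpow_neg zero_le_two, div_inv_eq_mul, mul_comm]
        gcongr
        exact norm_add_le _ _
      · have h1 : ‖x‖ - ‖y‖ ≤ ‖x + y‖ := by
          have := norm_sub_norm_le x (-y); simpa using this
        have h2 : ‖x‖ - ‖y‖ ≤ ‖x - y‖ := norm_sub_norm_le x y
        rw [hz (x + y) (by linarith), hz (x - y) (by linarith)]
        simp
    have hi1 : Integrable fun y => ‖g (x + y)‖ := (hgi.comp_add_left x).norm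
    have hi2 : Integrable fun y => ‖g (x - y)‖ := (hgi.comp_sub_left x).norm
    refine (norm_integral_le_of_norm_le (((hi1.add hi2).const_mul (1 / 2)).const_mul _)
      (Eventually.of_forall hle)).trans_eq ?_
    rw [integral_const_mul, integral_const_mul]
    simp only [Pi.add_apply]
    rw [integral_add hi1 hi2, integral_add_left_eq_self (fun y => ‖g y‖),
      integral_sub_left_eq_self (fun y => ‖g y‖)]
    ring

end NonlocalOp

theorem fracLap_eq_nonlocalOp {n : ℕ} (hn : 1 ≤ n) {σ : ℝ} (hσ : σ ∈ Set.Ioo (0 : ℝ) 1)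
    {φ : EuclideanSpace ℝ (Fin n) → ℝ} (hφ : ContDiff ℝ 2 φ) (hs : HasCompactSupport φ)
    (x : EuclideanSpace ℝ (Fin n)) :
    fracLap n σ φ x = fracConst n σ * nonlocalOp ((n : ℝ) + 2 * σ) φ x := by
  have : NeZero n := ⟨by omega⟩
  obtain ⟨hσ0, hσ1⟩ := hσ
  set p : ℝ := (n : ℝ) + 2 * σ with hpdef
  have hfin : finrank ℝ (EuclideanSpace ℝ (Fin n)) = n := finrank_euclideanSpace_fin
  have hp : (finrank ℝ (EuclideanSpace ℝ (Fin n)) : ℝ) < p := by rw [hfin]; linarith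
  have hp' : p < finrank ℝ (EuclideanSpace ℝ (Fin n)) + 2 := by rw [hfin]; linarith
  have hint := integrable_nonlocalOp hp hp' hφ hs x
  unfold fracLap
  congr 1
  refine Tendsto.limUnder_eq ?_
  have hS : ∀ ε : ℝ, MeasurableSet {y : EuclideanSpace ℝ (Fin n) | ε < ‖y‖} := fun ε =>
    measurableSet_lt measurable_const measurable_norm
  have htrunc : ∀ ε > 0, ∫ y in {y : EuclideanSpace ℝ (Fin n) | ε < ‖x - y‖},
      (φ x - φ y) / ‖x - y‖ ^ p =
      ∫ y, {y : EuclideanSpace ℝ (Fin n) | ε < ‖y‖}.indicator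
        (fun y => ‖y‖ ^ (-p) • secondDiff φ x y) y := by
    intro ε hε
    set F : EuclideanSpace ℝ (Fin n) → ℝ := {y | ε < ‖y‖}.indicator
      (fun z => ‖z‖ ^ (-p) * (φ x - φ (x + z))) with hF
    obtain ⟨A, hA⟩ := hs.exists_bound_of_continuous hφ.continuous
    have hFi : Integrable F := by
      rw [hF, integrable_indicator_iff (hS ε)]
      refine ((integrableOn_norm_rpow_neg hp hp' hε).mul_const (2 * A)).mono' ?_
        (Eventually.of_forall fun z => ?_)
      · have := hφ.continuous.measurable
        exact Measurable.aestronglyMeasurable (by fun_prop)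
      · rw [norm_mul, Real.norm_of_nonneg (by positivity : 0 ≤ ‖z‖ ^ (-p))]
        gcongr
        exact (norm_sub_le _ _).trans (by linarith [hA x, hA (x + z)])
    have h1 : ∫ y in {y : EuclideanSpace ℝ (Fin n) | ε < ‖x - y‖},
        (φ x - φ y) / ‖x - y‖ ^ p = ∫ y, F (y - x) := by
      rw [← integral_indicator (measurableSet_lt measurable_const (by fun_prop))]
      refine integral_congr_ae (Eventually.of_forall fun y => ?_)
      simp only [hF, Set.indicator, Set.mem_ofPred_eq, norm_sub_rev x y, add_sub_cancel]
      split_ifs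
      · rw [rpow_neg (norm_nonneg _)]; ring
      · rfl
    have h2 : ∫ y, F (-y) = ∫ y, F y := integral_neg_eq_self F volume
    rw [h1, integral_sub_right_eq_self F x]
    calc ∫ y, F y = (1 / 2) * ((∫ y, F y) + ∫ y, F (-y)) := by rw [h2]; ring
      _ = ∫ y, (1 / 2) * (F y + F (-y)) := by
        rw [← integral_add hFi hFi.comp_neg, integral_const_mul]
      _ = _ := by
        refine integral_congr_ae (Eventually.of_forall fun y => ?_)
        simp only [hF, Set.indicator, Set.mem_ofPred_eq, norm_neg, secondDiff, smul_eq_mul,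
          ← sub_eq_add_neg]
        split_ifs <;> ring
  have hlim : Tendsto (fun ε : ℝ => ∫ y, {y : EuclideanSpace ℝ (Fin n) | ε < ‖y‖}.indicator
      (fun y => ‖y‖ ^ (-p) • secondDiff φ x y) y) (𝓝[>] 0) (𝓝 (nonlocalOp p φ x)) := by
    refine tendsto_integral_filter_of_dominated_convergence _
      (Eventually.of_forall fun ε => hint.aestronglyMeasurable.indicator (hS ε))
      (Eventually.of_forall fun ε => Eventually.of_forall fun y => norm_indicator_le_norm_self _ _)
      hint.norm ?_
    have h0 : ∀ᵐ y : EuclideanSpace ℝ (Fin n), y ≠ 0 := Measure.ae_ne volume 0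
    refine h0.mono fun y hy => tendsto_const_nhds.congr' ?_
    filter_upwards [Ioo_mem_nhdsGT (norm_pos_iff.2 hy)] with ε hε
    rw [Set.indicator_of_mem]
    exact hε.2
  refine hlim.congr' ?_
  filter_upwards [self_mem_nhdsWithin] with ε hε
  exact (htrunc ε hε).symm

section Symmetries

variable {E G : Type*} [NormedAddCommGroup E] [InnerProductSpace ℝ E] [FiniteDimensional ℝ E]
  [MeasurableSpace E] [BorelSpace E] [NormedAddCommGroup G] [NormedSpace ℝ G] {p : ℝ}

theorem nonlocalOp_comp_smul_sub (p : ℝ) (g : E → G) {t : ℝ} (ht : 0 < t) (x y : E) :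
    nonlocalOp p (fun z => g (t • (z - x))) y =
      t ^ (p - finrank ℝ E) • nonlocalOp p g (t • (y - x)) := by
  unfold nonlocalOp
  have h : ∀ w : E, ‖w‖ ^ (-p) • secondDiff (fun z => g (t • (z - x))) y w =
      t ^ p • (fun w => ‖w‖ ^ (-p) • secondDiff g (t • (y - x)) w) (t • w) := by
    intro w
    simp only [norm_smul, Real.norm_of_nonneg ht.le, secondDiff, smul_smul]
    rw [mul_rpow ht.le (norm_nonneg _), ← mul_assoc, ← rpow_add ht, add_neg_cancel, rpow_zero,
      one_mul, ← smul_add, ← smul_sub, add_sub_right_comm, sub_right_comm]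
  simp_rw [h]
  rw [integral_smul, Measure.integral_comp_smul volume
    (fun w : E => ‖w‖ ^ (-p) • secondDiff g (t • (y - x)) w) t, smul_smul]
  congr 1
  rw [abs_of_nonneg (by positivity), rpow_sub ht, rpow_natCast, div_eq_mul_inv]

theorem nonlocalOp_eq_of_norm_eq (p : ℝ) {g : E → G} (hg : ∀ x y, ‖x‖ = ‖y‖ → g x = g y)
    {x y : E} (hxy : ‖x‖ = ‖y‖) : nonlocalOp p g x = nonlocalOp p g y := by
  set R := (ℝ ∙ (x - y))ᗮ.reflection
  have hR : R x = y := Submodule.reflection_sub hxy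
  have hgR : ∀ z, g (R z) = g z := fun z => hg _ _ (R.norm_map z)
  have hd : ∀ z w, secondDiff g (R z) (R w) = secondDiff g z w := fun z w => by
    simp only [secondDiff, ← map_add, ← map_sub, hgR]
  have h := R.measurePreserving.integral_comp R.toHomeomorph.measurableEmbedding
    (fun w => ‖w‖ ^ (-p) • secondDiff g (R x) w)
  simp only [hd, R.norm_map] at h
  rw [hR] at h
  exact h

theorem nonlocalOp_zero_pos [Nontrivial E] (hp : (finrank ℝ E : ℝ) < p)
    (hp' : p < finrank ℝ E + 2) {g : E → ℝ} (hg : ContDiff ℝ 2 g) (hs : HasCompactSupport g)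
    (hle : ∀ x, g x ≤ g 0) (hpos : 0 < g 0) : 0 < nonlocalOp p g 0 := by
  have hint := integrable_nonlocalOp hp hp' hg hs (0 : E)
  have hnn : ∀ y : E, 0 ≤ secondDiff g 0 y := fun y => by
    simp only [secondDiff, smul_eq_mul]
    linarith [hle (0 + y), hle (0 - y)]
  unfold nonlocalOp
  rw [integral_pos_iff_support_of_nonneg (fun y => by have := hnn y; positivity) hint]
  obtain ⟨R, hR⟩ := hs.isCompact.isBounded.subset_closedBall 0
  have hz : ∀ y, R < ‖y‖ → g y = 0 := fun y hy => by
    by_contra h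
    have := hR (subset_tsupport g h)
    rw [mem_closedBall_zero_iff] at this
    linarith
  have hopen : IsOpen {y : E | max R 0 < ‖y‖} := isOpen_lt continuous_const continuous_norm
  obtain ⟨e, he⟩ := NormedSpace.exists_lt_norm ℝ E (max R 0)
  refine (hopen.measure_pos volume ⟨e, he⟩).trans_le (measure_mono fun y hy => ?_)
  have hy1 : max R 0 < ‖y‖ := hy
  have hyR := (le_max_left _ _).trans_lt hy1
  have hy0 : 0 < ‖y‖ := (le_max_right _ _).trans_lt hy1
  simp only [Function.mem_support, secondDiff, zero_add, zero_sub, hz y hyR,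
    hz (-y) (by rwa [norm_neg]), smul_eq_mul, add_zero]
  rw [show g 0 - 1 / 2 * 0 = g 0 by ring]
  exact (mul_pos (rpow_pos_of_pos hy0 _) hpos).ne'

end Symmetries

section BallIntegrals

variable {E : Type*} [NormedAddCommGroup E] [InnerProductSpace ℝ E] [FiniteDimensional ℝ E]
  [MeasurableSpace E] [BorelSpace E] [Nontrivial E] {p : ℝ}

theorem integrable_prod_secondDiff (hp : (finrank ℝ E : ℝ) < p) (hp' : p < finrank ℝ E + 2)
    {g : E → ℝ} (hg : ContDiff ℝ 2 g) (hs : tsupport g ⊆ Metric.closedBall 0 1) :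
    Integrable (fun z : E × E => ‖z.2‖ ^ (-p) * secondDiff g z.1 z.2) (volume.prod volume) := by
  have hcs : HasCompactSupport g := HasCompactSupport.of_support_subset_isCompact
    (isCompact_closedBall 0 1) ((subset_tsupport g).trans hs)
  have hz : ∀ x, 1 < ‖x‖ → g x = 0 := fun x hx => by
    by_contra h
    have := hs (subset_tsupport g h)
    rw [mem_closedBall_zero_iff] at this
    linarith
  obtain ⟨A, hA0, hA⟩ := exists_norm_secondDiff_le hg hcs
  have hgi : Integrable (fun x => |g x|) :=
    (hg.continuous.integrable_of_hasCompactSupport hcs).norm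
  have hS : MeasurableSet {y : E | 1 / 2 < ‖y‖} := measurableSet_lt measurable_const measurable_norm
  have hk : Integrable ({y : E | 1 / 2 < ‖y‖}.indicator fun y => ‖y‖ ^ (-p)) :=
    (integrable_indicator_iff hS).2 (integrableOn_norm_rpow_neg hp hp' one_half_pos)
  have h1 : Integrable (fun z : E × E => (Metric.closedBall (0 : E) 2).indicator
      (fun _ => (1 : ℝ)) z.1 * (A * (min 1 (‖z.2‖ ^ 2) * ‖z.2‖ ^ (-p)))) (volume.prod volume) :=
    Integrable.mul_prod (f := (Metric.closedBall (0 : E) 2).indicator fun _ => (1 : ℝ))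
      (g := fun y : E => A * (min 1 (‖y‖ ^ 2) * ‖y‖ ^ (-p)))
      ((integrable_indicator_iff Metric.isClosed_closedBall.measurableSet).2
        (integrableOn_const (isCompact_closedBall (0 : E) 2).measure_lt_top.ne))
      ((integrable_min_one_sq_mul_rpow hp hp').const_mul A)
  have h2 : Integrable (fun z : E × E => ({y : E | 1 / 2 < ‖y‖}.indicator fun y => ‖y‖ ^ (-p)) z.2
      * |g (z.1 - z.2)|) (volume.prod volume) :=
    hk.convolution_integrand (ContinuousLinearMap.mul ℝ ℝ) hgi
  have h3 : Integrable (fun z : E × E => ({y : E | 1 / 2 < ‖y‖}.indicator fun y => ‖y‖ ^ (-p)) z.2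
      * |g (z.1 + z.2)|) (volume.prod volume) := by
    have hT : MeasurePreserving (fun z : E × E => (z.1, -z.2)) (volume.prod volume)
        (volume.prod volume) :=
      (MeasurePreserving.id volume).prod (Measure.measurePreserving_neg volume)
    refine (hT.integrable_comp_of_integrable h2).congr (Eventually.of_forall fun z => ?_)
    simp [Set.indicator]
  refine (h1.add (h2.add h3)).mono' ?_ (Eventually.of_forall fun z => ?_)
  · have := hg.continuous.measurable
    unfold secondDiff
    exact Measurable.aestronglyMeasurable (by fun_prop)
  · simp only [Pi.add_apply]
    rw [norm_mul, Real.norm_of_nonneg (by positivity)]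
    have hk0 : 0 ≤ ({y : E | 1 / 2 < ‖y‖}.indicator fun y => ‖y‖ ^ (-p)) z.2 :=
      Set.indicator_nonneg (fun y _ => by positivity) _
    by_cases hx : z.1 ∈ Metric.closedBall (0 : E) 2
    · rw [Set.indicator_of_mem hx]
      have := mul_le_mul_of_nonneg_left (hA z.1 z.2) (by positivity : 0 ≤ ‖z.2‖ ^ (-p))
      have : 0 ≤ ({y : E | 1 / 2 < ‖y‖}.indicator fun y => ‖y‖ ^ (-p)) z.2 * |g (z.1 - z.2)| := by
        positivity
      have : 0 ≤ ({y : E | 1 / 2 < ‖y‖}.indicator fun y => ‖y‖ ^ (-p)) z.2 * |g (z.1 + z.2)| := by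
        positivity
      linarith
    · rw [Set.indicator_of_notMem hx, zero_mul, zero_add]
      rw [mem_closedBall_zero_iff, not_le] at hx
      by_cases hy : 1 / 2 < ‖z.2‖
      · rw [Set.indicator_of_mem (show z.2 ∈ {y : E | 1 / 2 < ‖y‖} from hy), ← mul_add]
        gcongr
        rw [secondDiff, hz z.1 (by linarith), zero_sub, norm_neg, norm_smul, Real.norm_eq_abs,
          Real.norm_eq_abs, abs_of_pos one_half_pos]
        have := abs_add_le (g (z.1 + z.2)) (g (z.1 - z.2))
        have := abs_nonneg (g (z.1 + z.2))
        have := abs_nonneg (g (z.1 - z.2))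
        linarith
      · rw [not_lt] at hy
        have e1 : ‖z.1‖ - ‖z.2‖ ≤ ‖z.1 + z.2‖ := by
          have := norm_sub_norm_le z.1 (-z.2); simpa using this
        have e2 : ‖z.1‖ - ‖z.2‖ ≤ ‖z.1 - z.2‖ := norm_sub_norm_le z.1 z.2
        rw [secondDiff, hz z.1 (by linarith), hz (z.1 + z.2) (by linarith),
          hz (z.1 - z.2) (by linarith)]
        simp

theorem setIntegral_nonlocalOp (hp : (finrank ℝ E : ℝ) < p) (hp' : p < finrank ℝ E + 2)
    {g : E → ℝ} (hg : ContDiff ℝ 2 g) (hs : tsupport g ⊆ Metric.closedBall 0 1) (S : Set E) :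
    ∫ x in S, nonlocalOp p g x = ∫ y, ‖y‖ ^ (-p) * ∫ x in S, secondDiff g x y := by
  unfold nonlocalOp
  simp only [smul_eq_mul]
  rw [integral_integral_swap]
  · simp_rw [integral_const_mul]
  · rw [Measure.restrict_prod_eq_prod_univ]
    exact (integrable_prod_secondDiff hp hp' hg hs).integrableOn

theorem integral_nonlocalOp (hp : (finrank ℝ E : ℝ) < p) (hp' : p < finrank ℝ E + 2)
    {g : E → ℝ} (hg : ContDiff ℝ 2 g) (hs : tsupport g ⊆ Metric.closedBall 0 1) :
    ∫ x, nonlocalOp p g x = 0 := by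
  have hcs : HasCompactSupport g := HasCompactSupport.of_support_subset_isCompact
    (isCompact_closedBall 0 1) ((subset_tsupport g).trans hs)
  have hgi := hg.continuous.integrable_of_hasCompactSupport (μ := volume) hcs
  have h := setIntegral_nonlocalOp hp hp' hg hs Set.univ
  simp only [setIntegral_univ] at h
  rw [h]
  refine integral_eq_zero_of_ae (Eventually.of_forall fun y => ?_)
  have : ∫ x, secondDiff g x y = 0 := by
    have hi : Integrable fun x => (1 / 2 : ℝ) • (g (x + y) + g (x - y)) :=
      ((hgi.comp_add_right y).add (hgi.comp_sub_right y)).smul (1 / 2 : ℝ)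
    unfold secondDiff
    rw [integral_sub hgi hi, integral_smul, integral_add (hgi.comp_add_right y) (hgi.comp_sub_right y),
      integral_add_right_eq_self, integral_sub_right_eq_self, smul_eq_mul]
    ring
  simp [this]

theorem setIntegral_ball_comp_add_le {g : E → ℝ} (hg : Continuous g)
    (hmono : ∀ x y, ‖x‖ ≤ ‖y‖ → g y ≤ g x) {ρ : ℝ} (hρ : 0 ≤ ρ) (y : E) :
    ∫ x in Metric.ball (0 : E) ρ, g (x + y) ≤ ∫ x in Metric.ball (0 : E) ρ, g x := by
  have hcont : ∀ f : E → ℝ, Continuous f → IntegrableOn f (Metric.ball (0 : E) ρ) := fun f hf =>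
    (hf.continuousOn.integrableOn_compact (isCompact_closedBall (0 : E) ρ)).mono_set
      Metric.ball_subset_closedBall
  obtain ⟨e, he⟩ := exists_norm_eq E hρ
  have hm : ∀ f : E → ℝ, Continuous f → ∫ x in Metric.ball (0 : E) ρ, (f x - g e) =
      (∫ x in Metric.ball (0 : E) ρ, f x) - ∫ x in Metric.ball (0 : E) ρ, g e := fun f hf =>
    integral_sub (hcont f hf) (hcont _ continuous_const)
  suffices h : ∫ x in Metric.ball (0 : E) ρ, (g (x + y) - g e) ≤
      ∫ x in Metric.ball (0 : E) ρ, (g x - g e) by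
    rw [hm _ hg, hm (fun x => g (x + y)) (by fun_prop)] at h
    linarith
  have hB : MeasurableSet (Metric.ball (0 : E) ρ) := measurableSet_ball
  rw [← integral_indicator hB, ← integral_indicator hB,
    ← integral_sub_right_eq_self _ y]
  refine integral_mono
    (((integrable_indicator_iff hB).2 (hcont (fun x => g (x + y) - g e)
      (by fun_prop))).comp_sub_right y)
    ((integrable_indicator_iff hB).2 (hcont (fun x => g x - g e) (by fun_prop))) fun x => ?_
  simp only [Set.indicator, mem_ball_zero_iff, sub_add_cancel]
  split_ifs with h1 h2 h2
  · rfl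
  · linarith [hmono e x (by linarith)]
  · linarith [hmono x e (by linarith)]
  · rfl

theorem setIntegral_ball_nonlocalOp_nonneg (hp : (finrank ℝ E : ℝ) < p)
    (hp' : p < finrank ℝ E + 2) {g : E → ℝ} (hg : ContDiff ℝ 2 g)
    (hs : tsupport g ⊆ Metric.closedBall 0 1) (hmono : ∀ x y, ‖x‖ ≤ ‖y‖ → g y ≤ g x) {ρ : ℝ}
    (hρ : 0 ≤ ρ) : 0 ≤ ∫ x in Metric.ball (0 : E) ρ, nonlocalOp p g x := by
  have hcont : ∀ f : E → ℝ, Continuous f → IntegrableOn f (Metric.ball (0 : E) ρ) := fun f hf =>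
    (hf.continuousOn.integrableOn_compact (isCompact_closedBall (0 : E) ρ)).mono_set
      Metric.ball_subset_closedBall
  have hgc := hg.continuous
  rw [setIntegral_nonlocalOp hp hp' hg hs]
  refine integral_nonneg fun y => mul_nonneg (by positivity) ?_
  have h1 := setIntegral_ball_comp_add_le hgc hmono hρ y
  have h2 := setIntegral_ball_comp_add_le hgc hmono hρ (-y)
  simp only [← sub_eq_add_neg] at h2
  unfold secondDiff
  rw [integral_sub (hcont _ hgc) (hcont (fun x => (1 / 2 : ℝ) • (g (x + y) + g (x - y)))
      (by fun_prop)), integral_smul, integral_add (hcont (fun x => g (x + y)) (by fun_prop))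
      (hcont (fun x => g (x - y)) (by fun_prop)), smul_eq_mul]
  linarith

end BallIntegrals

section RadialAverage

variable {E G : Type*} [NormedAddCommGroup E] [NormedSpace ℝ E] [NormedAddCommGroup G]
  [NormedSpace ℝ G] {p : ℝ}

theorem iteratedFDeriv_pow_smul_comp_smul {H : E → G} (hH : ContDiff ℝ (⊤ : ℕ∞) H) (m k : ℕ)
    (s : ℝ) (x : E) :
    iteratedFDeriv ℝ k (fun x => s ^ m • H (s • x)) x =
      s ^ (m + k) • iteratedFDeriv ℝ k H (s • x) := by
  have hH' : ContDiff ℝ k H := contDiff_infty.1 hH k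
  have hc : ContDiff ℝ k fun x : E => H (s • x) := hH'.comp (contDiff_const_smul s)
  rw [iteratedFDeriv_const_smul_apply' hc.contDiffAt, iteratedFDeriv_comp_const_smul s hH',
    smul_smul, pow_add]

/-- The average `∫₀¹ sᵐ H(s x) ds` along the segment from the origin to `x`. -/
noncomputable def segmentAverage (m : ℕ) (H : E → G) (x : E) : G :=
  ∫ s in Set.Ioc (0 : ℝ) 1, s ^ m • H (s • x)

theorem hasFTaylorSeriesUpTo_segmentAverage [CompleteSpace G] (m : ℕ) {H : E → G}
    (hH : ContDiff ℝ (⊤ : ℕ∞) H)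
    (hb : ∀ k : ℕ, ∃ C : ℝ, 0 ≤ C ∧ ∀ x, ‖iteratedFDeriv ℝ k H x‖ ≤ C) :
    HasFTaylorSeriesUpTo (⊤ : ℕ∞) (segmentAverage m H)
      (fun x k => segmentAverage (m + k) (iteratedFDeriv ℝ k H) x) := by
  have h := hasFTaylorSeriesUpTo_integral (μ := volume.restrict (Set.Ioc (0 : ℝ) 1))
    (f := fun (x : E) s => s ^ m • H (s • x)) (fun s => ?_) (fun k x => ?_) (fun k x => ?_)
  · simp only [iteratedFDeriv_pow_smul_comp_smul hH] at h
    exact h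
  · exact contDiff_const.smul (hH.comp (contDiff_const_smul s))
  · simp only [iteratedFDeriv_pow_smul_comp_smul hH]
    have := hH.continuous_iteratedFDeriv (m := k) (by exact_mod_cast le_top)
    exact Continuous.aestronglyMeasurable (by fun_prop)
  · obtain ⟨C, hC0, hC⟩ := hb k
    refine ⟨fun _ => C, integrable_const C, (ae_restrict_iff' measurableSet_Ioc).2
      (Eventually.of_forall fun s hs z _ => ?_)⟩
    rw [iteratedFDeriv_pow_smul_comp_smul hH, norm_smul, norm_pow, Real.norm_of_nonneg hs.1.le]
    calc s ^ (m + k) * ‖iteratedFDeriv ℝ k H (s • z)‖ ≤ 1 * C := by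
          gcongr
          · exact pow_le_one₀ hs.1.le hs.2
          · exact hC _
      _ = C := one_mul C

theorem exists_norm_segmentAverage_le {m : ℕ} {H : E → G} {C : ℝ} (hp : 0 ≤ p)
    (hm : p < m + 1) (hH : ∀ x, ‖H x‖ ≤ C * (1 + ‖x‖) ^ (-p)) (hC : 0 ≤ C) :
    ∃ C' : ℝ, 0 ≤ C' ∧ ∀ x, ‖segmentAverage m H x‖ ≤ C' * (1 + ‖x‖) ^ (-p) := by
  have hi : IntegrableOn (fun s : ℝ => s ^ ((m : ℝ) - p)) (Set.Ioc 0 1) :=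
    (intervalIntegrable_iff_integrableOn_Ioc_of_le zero_le_one).1
      (intervalIntegral.intervalIntegrable_rpow' (by linarith))
  refine ⟨(∫ s in Set.Ioc (0 : ℝ) 1, s ^ ((m : ℝ) - p)) * C, mul_nonneg
    (setIntegral_nonneg measurableSet_Ioc fun s hs => rpow_nonneg hs.1.le _) hC, fun x => ?_⟩
  rw [mul_assoc, ← integral_mul_const]
  refine norm_integral_le_of_norm_le (hi.mul_const _) ((ae_restrict_iff' measurableSet_Ioc).2
    (Eventually.of_forall fun s hs => ?_))
  rw [norm_smul, norm_pow, Real.norm_of_nonneg hs.1.le]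
  have hx : 0 < 1 + ‖x‖ := by positivity
  have h1 : (1 + ‖s • x‖) ^ (-p) ≤ (s * (1 + ‖x‖)) ^ (-p) := by
    refine rpow_le_rpow_of_nonpos (mul_pos hs.1 hx) ?_ (by linarith)
    rw [norm_smul, Real.norm_of_nonneg hs.1.le]
    linarith [hs.2]
  rw [mul_rpow hs.1.le hx.le] at h1
  have hs0 : 0 < s ^ m := pow_pos hs.1 m
  calc s ^ m * ‖H (s • x)‖ ≤ s ^ m * (C * (s ^ (-p) * (1 + ‖x‖) ^ (-p))) := by
        gcongr
        exact (hH _).trans (by gcongr)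
    _ = (s ^ (m : ℝ) * s ^ (-p)) * (C * (1 + ‖x‖) ^ (-p)) := by rw [rpow_natCast]; ring
    _ = _ := by rw [← rpow_add hs.1, sub_eq_add_neg]

theorem pow_succ_smul_segmentAverage (m : ℕ) (H : E → G) (s : ℝ) (x : E) :
    s ^ (m + 1) • segmentAverage m H (s • x) = ∫ τ in (0 : ℝ)..s, τ ^ m • H (τ • x) := by
  unfold segmentAverage
  rw [← intervalIntegral.integral_of_le zero_le_one]
  have h := intervalIntegral.smul_integral_comp_mul_right (a := 0) (b := 1)
    (fun τ : ℝ => τ ^ m • H (τ • x)) s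
  rw [zero_mul, one_mul] at h
  rw [← h, pow_succ', mul_smul, ← intervalIntegral.integral_smul]
  simp only [mul_pow, smul_smul, mul_comm]

end RadialAverage

theorem norm_fderiv_le_of_norm_le {E : Type*} [NormedAddCommGroup E] [NormedSpace ℝ E]
    {f : E → ℝ} (hf : ContDiff ℝ 2 f) {x : E} {A B : ℝ}
    (hA : ∀ y, ‖y - x‖ ≤ 1 → ‖f y‖ ≤ A) (hB : ∀ y, ‖y - x‖ ≤ 1 → ‖iteratedFDeriv ℝ 2 f y‖ ≤ B) :
    ‖fderiv ℝ f x‖ ≤ 2 * A + B := by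
  have hB0 : 0 ≤ B := (norm_nonneg _).trans (hB x (by simp))
  have hA0 : 0 ≤ A := (norm_nonneg _).trans (hA x (by simp))
  have hd1 : Differentiable ℝ f := hf.differentiable (by norm_num)
  have hd2 : Differentiable ℝ (fderiv ℝ f) :=
    (hf.fderiv_right (m := 1) (by norm_num)).differentiable (by norm_num)
  have hconv : Convex ℝ (Metric.closedBall x 1) := convex_closedBall x 1
  have hlip : ∀ y, ‖y - x‖ ≤ 1 → ‖fderiv ℝ f y - fderiv ℝ f x‖ ≤ B := by
    intro y hy
    have h := hconv.norm_image_sub_le_of_norm_fderiv_le (𝕜 := ℝ) (f := fderiv ℝ f) (C := B)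
      (x := x) (y := y) (fun z _ => hd2 z) (fun z hz => ?_)
      (Metric.mem_closedBall_self zero_le_one) (by rwa [mem_closedBall_iff_norm])
    · exact h.trans (by nlinarith [norm_nonneg (y - x)])
    · have := hB z (by rwa [mem_closedBall_iff_norm] at hz)
      rwa [← norm_iteratedFDeriv_fderiv, norm_iteratedFDeriv_one] at this
  have key : ∀ e : E, ‖e‖ ≤ 1 → ‖fderiv ℝ f x e‖ ≤ 2 * A + B := by
    intro e he
    have hxe : ‖x + e - x‖ ≤ 1 := by rwa [add_sub_cancel_left]
    have h := hconv.norm_image_sub_le_of_norm_hasFDerivWithin_le' (𝕜 := ℝ) (f := f)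
      (f' := fderiv ℝ f) (φ := fderiv ℝ f x) (C := B) (x := x) (y := x + e)
      (fun z _ => (hd1 z).hasFDerivAt.hasFDerivWithinAt)
      (fun z hz => hlip z (by rwa [mem_closedBall_iff_norm] at hz))
      (Metric.mem_closedBall_self zero_le_one) (by rwa [mem_closedBall_iff_norm])
    rw [add_sub_cancel_left] at h
    have h1 := hA _ hxe
    have h2 := hA x (by simp)
    have h3 : fderiv ℝ f x e = f (x + e) - f x - (f (x + e) - f x - fderiv ℝ f x e) := by ring
    rw [h3]
    have := norm_sub_le (f (x + e) - f x) (f (x + e) - f x - fderiv ℝ f x e)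
    have := norm_sub_le (f (x + e)) (f x)
    nlinarith [norm_nonneg e]
  refine ContinuousLinearMap.opNorm_le_of_unit_norm (by positivity) fun e he => key e he.le

section RadialMass

variable {E : Type*} [NormedAddCommGroup E] [InnerProductSpace ℝ E] [FiniteDimensional ℝ E]
  [MeasurableSpace E] [BorelSpace E] [Nontrivial E] {p : ℝ}

theorem intervalIntegral_pow_mul_nonneg_of_ball {h : ℝ → ℝ} {ρ : ℝ} (hρ : 0 ≤ ρ)
    (hball : 0 ≤ ∫ x in Metric.ball (0 : E) ρ, h ‖x‖) :
    0 ≤ ∫ τ in (0 : ℝ)..ρ, τ ^ (finrank ℝ E - 1) • h τ := by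
  have h1 : ∫ x in Metric.ball (0 : E) ρ, h ‖x‖ =
      ∫ x : E, (Set.Iio ρ).indicator h ‖x‖ := by
    rw [← integral_indicator measurableSet_ball]
    simp [Set.indicator]
  have h2 := integral_fun_norm_addHaar (volume : Measure E) ((Set.Iio ρ).indicator h)
  have h3 : ∫ y in Set.Ioi (0 : ℝ), y ^ (finrank ℝ E - 1) • (Set.Iio ρ).indicator h y =
      ∫ τ in (0 : ℝ)..ρ, τ ^ (finrank ℝ E - 1) • h τ := by
    rw [intervalIntegral.integral_of_le hρ, integral_Ioc_eq_integral_Ioo,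
      ← Set.Ioi_inter_Iio, ← setIntegral_indicator measurableSet_Iio]
    congr 1 with y
    simp only [Set.indicator]
    split_ifs <;> simp
  rw [h1, h2, h3, nsmul_eq_mul, smul_eq_mul, ← mul_assoc] at hball
  refine nonneg_of_mul_nonneg_right hball (mul_pos ?_ ?_)
  · exact_mod_cast finrank_pos
  · exact ENNReal.toReal_pos (Metric.measure_ball_pos volume 0 one_pos).ne' measure_ball_lt_top.ne

theorem abs_intervalIntegral_pow_mul_le_of_integral_eq_zero (hp : (finrank ℝ E : ℝ) < p)
    {h : ℝ → ℝ} (hc : Continuous h) {C : ℝ} (hC : ∀ t, 0 ≤ t → ‖h t‖ ≤ C * (1 + t) ^ (-p))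
    (h0 : ∫ x : E, h ‖x‖ = 0) {ρ : ℝ} (hρ : 0 < ρ) :
    ‖∫ τ in (0 : ℝ)..ρ, τ ^ (finrank ℝ E - 1) • h τ‖ ≤
      C / (p - finrank ℝ E) * ρ ^ ((finrank ℝ E : ℝ) - p) := by
  have hp0 : 0 ≤ p := (Nat.cast_nonneg _).trans hp.le
  have hC0 : 0 ≤ C := by
    have := (norm_nonneg _).trans (hC 0 le_rfl)
    simpa using this
  have hcast : ∀ y : ℝ, y ^ (finrank ℝ E - 1) = y ^ ((finrank ℝ E : ℝ) - 1) := fun y => by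
    rw [← rpow_natCast, Nat.cast_sub (finrank_pos (R := ℝ) (M := E)), Nat.cast_one]
  have hi : Integrable fun x : E => h ‖x‖ := by
    refine ((integrable_one_add_norm (μ := (volume : Measure E)) hp).const_mul C).mono'
      (hc.comp continuous_norm).aestronglyMeasurable
      (Eventually.of_forall fun x => hC _ (norm_nonneg x))
  have hi' := (integrable_fun_norm_addHaar (volume : Measure E)).1 hi
  rw [integral_fun_norm_addHaar (volume : Measure E), nsmul_eq_mul, smul_eq_mul] at h0
  have h1 : ∫ y in Set.Ioi (0 : ℝ), y ^ (finrank ℝ E - 1) • h y = 0 := by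
    have hd : (finrank ℝ E : ℝ) ≠ 0 := by exact_mod_cast (finrank_pos (R := ℝ) (M := E)).ne'
    have hv : volume.real (Metric.ball (0 : E) 1) ≠ 0 :=
      (ENNReal.toReal_pos (Metric.measure_ball_pos volume 0 one_pos).ne' measure_ball_lt_top.ne).ne'
    simpa [hd, hv] using h0
  have h2 : ∫ τ in (0 : ℝ)..ρ, τ ^ (finrank ℝ E - 1) • h τ =
      - ∫ τ in Set.Ioi ρ, τ ^ (finrank ℝ E - 1) • h τ := by
    rw [← Set.Ioc_union_Ioi_eq_Ioi hρ.le, setIntegral_union (Set.Ioc_disjoint_Ioi le_rfl)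
      measurableSet_Ioi (hi'.mono_set Set.Ioc_subset_Ioi_self)
      (hi'.mono_set (Set.Ioi_subset_Ioi hρ.le))] at h1
    rw [intervalIntegral.integral_of_le hρ.le]
    linarith
  have hlt : (finrank ℝ E : ℝ) - 1 - p < -1 := by linarith
  have h3 := integral_Ioi_rpow_of_lt hlt hρ
  rw [h2, norm_neg]
  calc _ ≤ ∫ τ in Set.Ioi ρ, C * τ ^ ((finrank ℝ E : ℝ) - 1 - p) := by
        refine norm_integral_le_of_norm_le ((integrableOn_Ioi_rpow_of_lt hlt hρ).const_mul C)
          ((ae_restrict_iff' measurableSet_Ioi).2 (Eventually.of_forall fun τ hτ => ?_))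
        have hτ0 : 0 < τ := hρ.trans hτ
        rw [norm_smul, norm_pow, Real.norm_of_nonneg hτ0.le, hcast]
        calc _ ≤ τ ^ ((finrank ℝ E : ℝ) - 1) * (C * τ ^ (-p)) := by
              gcongr
              refine (hC τ hτ0.le).trans ?_
              gcongr ?_ * ?_
              exact rpow_le_rpow_of_nonpos hτ0 (by linarith) (by linarith)
          _ = C * (τ ^ ((finrank ℝ E : ℝ) - 1) * τ ^ (-p)) := by ring
          _ = _ := by rw [← rpow_add hτ0, sub_eq_add_neg _ p]
    _ = _ := by
      rw [integral_const_mul, h3]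
      have : p - finrank ℝ E ≠ 0 := by linarith
      have h4 : (finrank ℝ E : ℝ) - 1 - p + 1 = -(p - finrank ℝ E) := by ring
      rw [h4, neg_div_neg_eq, neg_sub]
      ring

end RadialMass

section Bump

variable {E : Type*} [NormedAddCommGroup E] [InnerProductSpace ℝ E]

theorem exists_contDiff_radial_bump : ∃ g : E → ℝ, ContDiff ℝ (⊤ : ℕ∞) g ∧
    tsupport g ⊆ Metric.closedBall 0 1 ∧ (∀ x y, ‖x‖ ≤ ‖y‖ → g y ≤ g x) ∧ 0 < g 0 := by
  refine ⟨fun x => expNegInvGlue (1 - ‖x‖ ^ 2), ?_, ?_, fun x y hxy => ?_, ?_⟩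
  · exact expNegInvGlue.contDiff.comp (contDiff_const.sub (contDiff_norm_sq ℝ))
  · refine closure_minimal (fun x hx => ?_) Metric.isClosed_closedBall
    rw [mem_closedBall_zero_iff]
    by_contra! h
    exact hx (expNegInvGlue.zero_of_nonpos (by nlinarith))
  · exact expNegInvGlue.monotone (by gcongr)
  · exact expNegInvGlue.pos_of_pos (by simp)

end Bump

section Kernel

variable (E : Type*) [NormedAddCommGroup E] [InnerProductSpace ℝ E] [FiniteDimensional ℝ E]
  [MeasurableSpace E] [BorelSpace E] [Nontrivial E] {p : ℝ}

theorem exists_mollifier_of_nonlocalOp (hp : (finrank ℝ E : ℝ) < p) (hp' : p < finrank ℝ E + 2) :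
    ∃ g M : E → ℝ, ContDiff ℝ (⊤ : ℕ∞) g ∧ tsupport g ⊆ Metric.closedBall 0 1 ∧
      (∀ x, nonlocalOp p g (-x) = nonlocalOp p g x) ∧
      ContDiff ℝ (⊤ : ℕ∞) M ∧
      (∀ k : ℕ, ∃ C : ℝ, 0 ≤ C ∧ ∀ x, ‖iteratedFDeriv ℝ k M x‖ ≤ C * (1 + ‖x‖) ^ (-p)) ∧
      ∫ x, M x ≠ 0 ∧
      (∀ s x, s ^ finrank ℝ E * M (s • x) =
        ∫ τ in (0 : ℝ)..s, τ ^ (finrank ℝ E - 1) * nonlocalOp p g (τ • x)) := by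
  have hp0 : 0 ≤ p := (Nat.cast_nonneg _).trans hp.le
  have hd : finrank ℝ E - 1 + 1 = finrank ℝ E := Nat.sub_add_cancel finrank_pos
  have hdc : ((finrank ℝ E - 1 : ℕ) : ℝ) + 1 = finrank ℝ E := by exact_mod_cast hd
  obtain ⟨g, hg, hsupp, hmono, hpos⟩ := exists_contDiff_radial_bump (E := E)
  have hcs : HasCompactSupport g := HasCompactSupport.of_support_subset_isCompact
    (isCompact_closedBall 0 1) ((subset_tsupport g).trans hsupp)
  have hg2 : ContDiff ℝ 2 g := contDiff_infty.1 hg 2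
  have hgrad : ∀ x y : E, ‖x‖ = ‖y‖ → g x = g y := fun x y h =>
    le_antisymm (hmono y x h.ge) (hmono x y h.le)
  set H : E → ℝ := nonlocalOp p g with hHdef
  have hHrad : ∀ x y : E, ‖x‖ = ‖y‖ → H x = H y := fun x y h => nonlocalOp_eq_of_norm_eq p hgrad h
  have hHser := hasFTaylorSeriesUpTo_nonlocalOp hp hp' hg hcs
  have hHsm : ContDiff ℝ (⊤ : ℕ∞) H := hHser.contDiff
  have hHk : ∀ k : ℕ, ∃ C : ℝ, 0 ≤ C ∧ ∀ x, ‖iteratedFDeriv ℝ k H x‖ ≤ C * (1 + ‖x‖) ^ (-p) := by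
    intro k
    obtain ⟨C, hC0, hC⟩ := exists_norm_nonlocalOp_le hp hp' (g := iteratedFDeriv ℝ k g)
      (contDiff_infty.1 (hg.iteratedFDeriv_right (m := (⊤ : ℕ∞)) (by exact_mod_cast le_top)) 2)
      ((tsupport_iteratedFDeriv_subset k).trans hsupp)
    refine ⟨C, hC0, fun x => ?_⟩
    rw [← hHser.eq_iteratedFDeriv (by exact_mod_cast le_top)]
    exact hC x
  have hone : ∀ x : E, (1 + ‖x‖) ^ (-p) ≤ 1 := fun x =>
    rpow_le_one_of_one_le_of_nonpos (by linarith [norm_nonneg x]) (by linarith)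
  have hHb : ∀ k : ℕ, ∃ C : ℝ, 0 ≤ C ∧ ∀ x, ‖iteratedFDeriv ℝ k H x‖ ≤ C := fun k => by
    obtain ⟨C, hC0, hC⟩ := hHk k
    exact ⟨C, hC0, fun x => (hC x).trans (mul_le_of_le_one_right hC0 (hone x))⟩
  obtain ⟨e, he⟩ := exists_norm_eq E zero_le_one
  set h : ℝ → ℝ := fun t => H (t • e) with hh
  have hhc : Continuous h := hHsm.continuous.comp (by fun_prop)
  have hHh : ∀ (τ : ℝ) (x : E), 0 ≤ τ → H (τ • x) = h (τ * ‖x‖) := fun τ x hτ =>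
    hHrad _ _ (by simp [norm_smul, he])
  have hHh1 : ∀ x : E, h ‖x‖ = H x := fun x => by simpa using (hHh 1 x zero_le_one).symm
  obtain ⟨C₀, hC₀0, hC₀⟩ := hHk 0
  have hhC : ∀ t, 0 ≤ t → ‖h t‖ ≤ C₀ * (1 + t) ^ (-p) := fun t ht => by
    have := hC₀ (t • e)
    rwa [norm_iteratedFDeriv_zero, norm_smul, he, mul_one, Real.norm_of_nonneg ht] at this
  set M : E → ℝ := segmentAverage (finrank ℝ E - 1) H with hM
  have hMser := hasFTaylorSeriesUpTo_segmentAverage (finrank ℝ E - 1) hHsm hHb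
  have hMsm : ContDiff ℝ (⊤ : ℕ∞) M := hMser.contDiff
  have hMs : ∀ (s : ℝ) (x : E), s ^ finrank ℝ E * M (s • x) =
      ∫ τ in (0 : ℝ)..s, τ ^ (finrank ℝ E - 1) * H (τ • x) := fun s x => by
    have := pow_succ_smul_segmentAverage (finrank ℝ E - 1) H s x
    simpa only [hd, smul_eq_mul] using this
  have hMx : ∀ x : E, ‖x‖ ^ finrank ℝ E * M x =
      ∫ τ in (0 : ℝ)..‖x‖, τ ^ (finrank ℝ E - 1) • h τ := by
    intro x
    have h1 := pow_succ_smul_segmentAverage (finrank ℝ E - 1) H 1 x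
    have h2 := intervalIntegral.smul_integral_comp_mul_right (a := 0) (b := 1)
      (fun τ : ℝ => τ ^ (finrank ℝ E - 1) • h τ) ‖x‖
    rw [zero_mul, one_mul] at h2
    rw [one_pow, one_smul, one_smul] at h1
    rw [← h2, hM, h1, ← hd, pow_succ', mul_assoc, smul_eq_mul, hd,
      ← intervalIntegral.integral_const_mul]
    congr 1
    refine intervalIntegral.integral_congr fun τ hτ => ?_
    rw [Set.uIcc_of_le zero_le_one] at hτ
    simp only [smul_eq_mul, mul_pow, hHh τ x hτ.1]
    ring
  have hMpos : ∀ x, 0 ≤ M x := by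
    intro x
    rcases eq_or_ne x 0 with rfl | hx
    · have hH0 : 0 < H 0 := nonlocalOp_zero_pos hp hp' hg2 hcs
        (fun x => hmono 0 x (by simp)) hpos
      exact setIntegral_nonneg measurableSet_Ioc fun s hs => by
        rw [smul_zero, smul_eq_mul]
        exact mul_nonneg (pow_nonneg hs.1.le _) hH0.le
    · have := intervalIntegral_pow_mul_nonneg_of_ball (E := E) (h := h) (norm_nonneg x) (by
        simp only [hHh1]
        exact setIntegral_ball_nonlocalOp_nonneg hp hp' hg2 hsupp hmono (norm_nonneg x))
      rw [← hMx] at this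
      exact nonneg_of_mul_nonneg_right this (by positivity)
  have hM0 : M 0 ≠ 0 := by
    have hH0 : 0 < H 0 := nonlocalOp_zero_pos hp hp' hg2 hcs (fun x => hmono 0 x (by simp)) hpos
    have h1 := pow_succ_smul_segmentAverage (finrank ℝ E - 1) H 1 0
    simp only [one_pow, smul_zero, smul_eq_mul, intervalIntegral.integral_mul_const,
      integral_pow, hdc, hd] at h1
    rw [one_mul] at h1
    rw [hM, h1]
    have : (finrank ℝ E : ℝ) ≠ 0 := by exact_mod_cast (finrank_pos (R := ℝ) (M := E)).ne'
    have h3 : finrank ℝ E ≠ 0 := (finrank_pos (R := ℝ) (M := E)).ne'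
    simp [h3, hH0.ne']
  have hMk2 : ∀ k : ℕ, 2 ≤ k →
      ∃ C : ℝ, 0 ≤ C ∧ ∀ x, ‖iteratedFDeriv ℝ k M x‖ ≤ C * (1 + ‖x‖) ^ (-p) := by
    intro k hk
    obtain ⟨C, hC0, hC⟩ := hHk k
    have hk' : (2 : ℝ) ≤ k := by exact_mod_cast hk
    obtain ⟨C', hC'0, hC'⟩ := exists_norm_segmentAverage_le (m := finrank ℝ E - 1 + k) hp0
      (by push_cast; linarith) hC hC0
    refine ⟨C', hC'0, fun x => ?_⟩
    rw [← hMser.eq_iteratedFDeriv (by exact_mod_cast le_top)]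
    exact hC' x
  have hMbd : ∃ C : ℝ, 0 ≤ C ∧ ∀ x, ‖M x‖ ≤ C := by
    obtain ⟨C, hC0, hC⟩ := hHb 0
    refine ⟨C, hC0, fun x => ?_⟩
    have : ∫ _ in Set.Ioc (0 : ℝ) 1, C = C := by simp
    rw [← this]
    refine norm_integral_le_of_norm_le (integrable_const C)
      ((ae_restrict_iff' measurableSet_Ioc).2 (Eventually.of_forall fun s hs => ?_))
    rw [norm_smul, norm_pow, Real.norm_of_nonneg hs.1.le]
    have := hC (s • x)
    rw [norm_iteratedFDeriv_zero] at this
    exact (mul_le_of_le_one_left (norm_nonneg _) (pow_le_one₀ hs.1.le hs.2)).trans this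
  have hMk0 : ∃ C : ℝ, 0 ≤ C ∧ ∀ x, ‖M x‖ ≤ C * (1 + ‖x‖) ^ (-p) := by
    obtain ⟨C, hC0, hC⟩ := hMbd
    have hpd : 0 < p - finrank ℝ E := by linarith
    refine ⟨_, ?_, fun x => le_one_add_rpow_of_le (norm_nonneg x) hp0 (hC x) hC0
      (B := C₀ / (p - finrank ℝ E)) (by positivity) le_rfl fun hx => ?_⟩
    · positivity
    · have hx0 : 0 < ‖x‖ := by linarith
      have h1 := abs_intervalIntegral_pow_mul_le_of_integral_eq_zero hp hhc hhC
        (by simp only [hHh1]; exact integral_nonlocalOp hp hp' hg2 hsupp) hx0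
      rw [← hMx, norm_mul, norm_pow, norm_norm, sub_eq_add_neg (finrank ℝ E : ℝ), rpow_add hx0, rpow_natCast] at h1
      refine le_of_mul_le_mul_left (h1.trans_eq ?_) (pow_pos hx0 (finrank ℝ E))
      ring
  have hMk1 : ∃ C : ℝ, 0 ≤ C ∧ ∀ x, ‖iteratedFDeriv ℝ 1 M x‖ ≤ C * (1 + ‖x‖) ^ (-p) := by
    obtain ⟨A, hA0, hA⟩ := hMk0
    obtain ⟨B, hB0, hB⟩ := hMk2 2 le_rfl
    refine ⟨2 * (A * 2 ^ p) + B * 2 ^ p, by positivity, fun x => ?_⟩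
    have hxy : ∀ y : E, ‖y - x‖ ≤ 1 → (1 + ‖y‖) ^ (-p) ≤ 2 ^ p * (1 + ‖x‖) ^ (-p) := by
      intro y hy
      have h1 : ‖x‖ ≤ ‖y‖ + 1 := by
        have := norm_sub_norm_le x y
        rw [norm_sub_rev] at this
        linarith
      calc (1 + ‖y‖) ^ (-p) ≤ ((1 + ‖x‖) / 2) ^ (-p) :=
            rpow_le_rpow_of_nonpos (by positivity) (by linarith [norm_nonneg y]) (by linarith)
        _ = _ := by
          rw [div_rpow (by positivity) zero_le_two, rpow_neg zero_le_two, div_inv_eq_mul, mul_comm]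
    rw [norm_iteratedFDeriv_one]
    refine (norm_fderiv_le_of_norm_le (contDiff_infty.1 hMsm 2)
      (A := A * (2 ^ p * (1 + ‖x‖) ^ (-p))) (B := B * (2 ^ p * (1 + ‖x‖) ^ (-p)))
      (fun y hy => (hA y).trans ?_) (fun y hy => (hB y).trans ?_)).trans_eq (by ring)
    · gcongr; exact hxy y hy
    · gcongr; exact hxy y hy
  have hMi : Integrable M := by
    obtain ⟨C, hC0, hC⟩ := hMk0
    exact ((integrable_one_add_norm hp).const_mul C).mono' hMsm.continuous.aestronglyMeasurable
      (Eventually.of_forall hC)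
  refine ⟨g, M, hg, hsupp, fun x => hHrad _ _ (norm_neg x), hMsm, fun k => ?_, ?_, hMs⟩
  · match k with
    | 0 => simpa only [norm_iteratedFDeriv_zero] using hMk0
    | 1 => exact hMk1
    | k + 2 => exact hMk2 (k + 2) (by omega)
  · exact (integral_pos_of_integrable_nonneg_nonzero hMsm.continuous hMi hMpos hM0).ne'

end Kernel

section Mollification

variable {E : Type*} [NormedAddCommGroup E] [InnerProductSpace ℝ E] [FiniteDimensional ℝ E]
  [MeasurableSpace E] [BorelSpace E] {p : ℝ} {u M H : E → ℝ}

omit [FiniteDimensional ℝ E] [MeasurableSpace E] [BorelSpace E] in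
theorem one_add_norm_smul_sub_rpow_le (hp : 0 ≤ p) {a R s : ℝ} (ha : 0 < a) (hR : 0 ≤ R)
    (hs : a ≤ s) {x : E} (hx : ‖x‖ ≤ R) (y : E) :
    (1 + ‖s • (x - y)‖) ^ (-p) ≤ ((1 + R) * (1 + a⁻¹)) ^ p * (1 + ‖y‖) ^ (-p) := by
  have hs0 : 0 < s := ha.trans_le hs
  have hL : 0 < (1 + R) * (1 + a⁻¹) := by positivity
  have h1 : 1 + ‖y‖ ≤ (1 + R) * (1 + a⁻¹) * (1 + ‖s • (x - y)‖) := by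
    rw [norm_smul, Real.norm_of_nonneg hs0.le]
    have h2 : ‖y‖ ≤ R + ‖x - y‖ := by
      have := norm_sub_norm_le y x
      rw [norm_sub_rev] at this
      linarith
    have h3 : ‖x - y‖ ≤ a⁻¹ * (s * ‖x - y‖) := by
      rw [← mul_assoc]
      refine le_mul_of_one_le_left (norm_nonneg _) ?_
      rw [inv_mul_eq_div, one_le_div ha]
      exact hs
    have h4 : 0 ≤ s * ‖x - y‖ := by positivity
    have h5 : 0 < a⁻¹ := by positivity
    nlinarith [mul_nonneg hR h5.le, mul_nonneg hR h4, mul_nonneg (mul_nonneg hR h5.le) h4]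
  have h6 : ((1 + R) * (1 + a⁻¹) * (1 + ‖s • (x - y)‖)) ^ (-p) ≤ (1 + ‖y‖) ^ (-p) :=
    rpow_le_rpow_of_nonpos (by positivity) h1 (by linarith)
  rw [mul_rpow hL.le (by positivity)] at h6
  calc _ = ((1 + R) * (1 + a⁻¹)) ^ p * (((1 + R) * (1 + a⁻¹)) ^ (-p) *
        (1 + ‖s • (x - y)‖) ^ (-p)) := by
        rw [← mul_assoc, ← rpow_add hL, add_neg_cancel, rpow_zero, one_mul]
    _ ≤ _ := by gcongr

/-- The convolution of `u` with the rescaled kernel `s^d M(s ·)`. -/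
noncomputable def mollify (M u : E → ℝ) (s : ℝ) (x : E) : ℝ :=
  ∫ y, u y * (s ^ finrank ℝ E * M (s • (x - y)))

omit [FiniteDimensional ℝ E] [MeasurableSpace E] [BorelSpace E] in
theorem iteratedFDeriv_mollify_kernel (hM : ContDiff ℝ (⊤ : ℕ∞) M) (k : ℕ) (b s : ℝ) (x y : E) :
    iteratedFDeriv ℝ k (fun x => b * (s ^ finrank ℝ E * M (s • (x - y)))) x =
      (b * s ^ (finrank ℝ E + k)) • iteratedFDeriv ℝ k M (s • (x - y)) := by
  have hM' : ContDiff ℝ k fun x : E => s ^ finrank ℝ E • M (s • x) :=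
    contDiff_const.mul ((contDiff_infty.1 hM k).comp (contDiff_const_smul s))
  have h1 := iteratedFDeriv_comp_sub (𝕜 := ℝ)
    (f := fun x : E => b • (s ^ finrank ℝ E • M (s • x))) k y x
  rw [iteratedFDeriv_const_smul_apply' hM'.contDiffAt, iteratedFDeriv_pow_smul_comp_smul hM,
    smul_smul] at h1
  exact h1

theorem hasFTaylorSeriesUpTo_mollify (hp : 0 ≤ p) (hum : AEStronglyMeasurable u)
    (hu : Integrable fun y => |u y| * (1 + ‖y‖) ^ (-p)) (hM : ContDiff ℝ (⊤ : ℕ∞) M)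
    (hMk : ∀ k : ℕ, ∃ C : ℝ, 0 ≤ C ∧ ∀ x, ‖iteratedFDeriv ℝ k M x‖ ≤ C * (1 + ‖x‖) ^ (-p))
    {s : ℝ} (hs : 0 < s) :
    HasFTaylorSeriesUpTo (⊤ : ℕ∞) (mollify M u s) fun x k =>
      ∫ y, (u y * s ^ (finrank ℝ E + k)) • iteratedFDeriv ℝ k M (s • (x - y)) := by
  have h := hasFTaylorSeriesUpTo_integral (μ := (volume : Measure E))
    (f := fun x y => u y * (s ^ finrank ℝ E * M (s • (x - y)))) (fun y => ?_) (fun k x => ?_)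
    (fun k x => ?_)
  · simp only [iteratedFDeriv_mollify_kernel hM] at h
    exact h
  · exact contDiff_const.mul (contDiff_const.mul (hM.comp
      ((contDiff_const_smul s).comp (contDiff_id.sub contDiff_const))))
  · simp only [iteratedFDeriv_mollify_kernel hM]
    have := hM.continuous_iteratedFDeriv (m := k) (by exact_mod_cast le_top)
    exact (hum.mul_const _).smul (Continuous.aestronglyMeasurable (by fun_prop))
  · obtain ⟨C, hC0, hC⟩ := hMk k
    refine ⟨_, (hu.const_mul (s ^ (finrank ℝ E + k) * C *
      ((1 + (‖x‖ + 1)) * (1 + s⁻¹)) ^ p)), Eventually.of_forall fun y z hz => ?_⟩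
    have hz' : ‖z‖ ≤ ‖x‖ + 1 := by
      have := norm_sub_norm_le z x
      have h2 := mem_ball_iff_norm.1 hz
      linarith
    rw [iteratedFDeriv_mollify_kernel hM, norm_smul, norm_mul, norm_pow,
      Real.norm_of_nonneg hs.le, Real.norm_eq_abs]
    have h3 := one_add_norm_smul_sub_rpow_le hp hs (by positivity) le_rfl hz' y
    calc _ ≤ |u y| * s ^ (finrank ℝ E + k) * (C * (((1 + (‖x‖ + 1)) * (1 + s⁻¹)) ^ p *
          (1 + ‖y‖) ^ (-p))) := by
          gcongr
          exact (hC _).trans (by gcongr)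
      _ = _ := by ring

theorem mollify_eq_mollify [Nontrivial E] (hp : 0 ≤ p) (hum : AEStronglyMeasurable u)
    (hu : Integrable fun y => |u y| * (1 + ‖y‖) ^ (-p)) (hH : Continuous H) (hM : Continuous M)
    {C : ℝ} (hHC : ∀ x, ‖H x‖ ≤ C * (1 + ‖x‖) ^ (-p)) (hMC : ∀ x, ‖M x‖ ≤ C * (1 + ‖x‖) ^ (-p))
    (hMH : ∀ s x, s ^ finrank ℝ E * M (s • x) =
      ∫ τ in (0 : ℝ)..s, τ ^ (finrank ℝ E - 1) * H (τ • x))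
    {s t : ℝ} (hs : 0 < s) (hst : s ≤ t) {x : E}
    (hz : ∀ τ, s ≤ τ → ∫ y, u y * H (τ • (x - y)) = 0) :
    mollify M u t x = mollify M u s x := by
  have hC0 : 0 ≤ C := by
    have := (norm_nonneg _).trans (hMC 0)
    simpa using this
  set K := ((1 + ‖x‖) * (1 + s⁻¹)) ^ p
  have hK : ∀ τ, s ≤ τ → ∀ y, (1 + ‖τ • (x - y)‖) ^ (-p) ≤ K * (1 + ‖y‖) ^ (-p) := fun τ hτ y =>
    one_add_norm_smul_sub_rpow_le hp hs (norm_nonneg x) hτ le_rfl y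
  have hi : ∀ τ, s ≤ τ →
      Integrable fun y => u y * (τ ^ finrank ℝ E * M (τ • (x - y))) := fun τ hτ => by
    refine (hu.const_mul (τ ^ finrank ℝ E * C * K)).mono'
      (hum.mul (Continuous.aestronglyMeasurable (by fun_prop))) (Eventually.of_forall fun y => ?_)
    have hτ0 : 0 ≤ τ := hs.le.trans hτ
    rw [norm_mul, norm_mul, norm_pow, Real.norm_of_nonneg hτ0, Real.norm_eq_abs]
    calc _ ≤ |u y| * (τ ^ finrank ℝ E * (C * (K * (1 + ‖y‖) ^ (-p)))) := by
          gcongr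
          exact (hMC _).trans (by gcongr; exact hK τ hτ y)
      _ = _ := by ring
  have hci : ∀ (y : E) (a b : ℝ), IntervalIntegrable
      (fun τ : ℝ => τ ^ (finrank ℝ E - 1) * H (τ • (x - y))) volume a b := fun y a b =>
    Continuous.intervalIntegrable (by fun_prop) _ _
  rw [← sub_eq_zero]
  unfold mollify
  rw [← integral_sub (hi t hst) (hi s le_rfl)]
  have h1 : ∀ y, u y * (t ^ finrank ℝ E * M (t • (x - y))) -
      u y * (s ^ finrank ℝ E * M (s • (x - y))) =
      ∫ τ in Set.Ioc s t, u y * (τ ^ (finrank ℝ E - 1) * H (τ • (x - y))) := fun y => by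
    rw [hMH, hMH, ← mul_sub, intervalIntegral.integral_interval_sub_left (hci y _ _) (hci y _ _),
      intervalIntegral.integral_of_le hst, integral_const_mul]
  simp only [h1]
  rw [integral_integral_swap]
  · refine setIntegral_eq_zero_of_forall_eq_zero fun τ hτ => ?_
    have h2 : ∀ y, u y * (τ ^ (finrank ℝ E - 1) * H (τ • (x - y))) =
        τ ^ (finrank ℝ E - 1) * (u y * H (τ • (x - y))) := fun y => by ring
    simp only [h2]
    rw [integral_const_mul, hz τ hτ.1.le, mul_zero]
  · have hb := hu.mul_prod (ν := volume.restrict (Set.Ioc s t))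
      (integrable_const (t ^ (finrank ℝ E - 1) * C * K))
    refine hb.mono' (hum.comp_fst.mul (Continuous.aestronglyMeasurable (by fun_prop))) ?_
    have hae : ∀ᵐ z : E × ℝ ∂(volume.prod (volume.restrict (Set.Ioc s t))), z.2 ∈ Set.Ioc s t :=
      Measure.quasiMeasurePreserving_snd.ae (ae_restrict_mem measurableSet_Ioc)
    filter_upwards [hae] with z hz2
    have hτ0 : 0 ≤ z.2 := hs.le.trans hz2.1.le
    simp only [Function.uncurry]
    rw [norm_mul, norm_mul, norm_pow, Real.norm_of_nonneg hτ0, Real.norm_eq_abs]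
    calc _ ≤ |u z.1| * (t ^ (finrank ℝ E - 1) * (C * (K * (1 + ‖z.1‖) ^ (-p)))) := by
          gcongr
          · have := hs.le.trans hst
            positivity
          · exact hz2.2
          · exact (hHC _).trans (by gcongr; exact hK _ hz2.1.le _)
      _ = _ := by ring

theorem integral_mollify_mul (hp : 0 ≤ p) (hum : AEStronglyMeasurable u)
    (hu : Integrable fun y => |u y| * (1 + ‖y‖) ^ (-p)) (hM : Continuous M)
    {C : ℝ} (hMC : ∀ x, ‖M x‖ ≤ C * (1 + ‖x‖) ^ (-p)) {ψ : E → ℝ} (hψ : Continuous ψ)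
    (hψs : HasCompactSupport ψ) {s : ℝ} (hs : 0 < s) :
    ∫ x, mollify M u s x * ψ x = ∫ y, u y * ∫ z, M z * ψ (y + s⁻¹ • z) := by
  have hC0 : 0 ≤ C := by
    have := (norm_nonneg _).trans (hMC 0)
    simpa using this
  obtain ⟨R, hR0, hR⟩ := hψs.isCompact.isBounded.subset_closedBall_lt 0 0
  set K := ((1 + R) * (1 + s⁻¹)) ^ p
  unfold mollify
  simp only [← integral_mul_const]
  rw [integral_integral_swap]
  · congr 1 with y
    simp only [mul_assoc, integral_const_mul]
    congr 1
    have h1 := Measure.integral_comp_smul volume (fun z => M z * ψ (y + s⁻¹ • z)) s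
    rw [← integral_sub_right_eq_self _ y] at h1
    rw [abs_of_nonneg (by positivity), eq_inv_smul_iff₀ (by positivity)] at h1
    rw [← h1, smul_eq_mul]
    congr 2 with x
    rw [smul_smul, inv_mul_cancel₀ hs.ne', one_smul, add_sub_cancel]
  · have hb := ((hψ.integrable_of_hasCompactSupport hψs (μ := volume)).norm.const_mul
      (s ^ finrank ℝ E * C * K)).mul_prod hu
    refine hb.mono' (((hum.comp_snd).mul (Continuous.aestronglyMeasurable (by fun_prop))).mul
      (Continuous.aestronglyMeasurable (by fun_prop))) (Eventually.of_forall fun z => ?_)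
    simp only [Function.uncurry]
    by_cases hz : ψ z.1 = 0
    · simp [hz]
    · have hz1 : ‖z.1‖ ≤ R := mem_closedBall_zero_iff.1 (hR (subset_tsupport ψ hz))
      rw [norm_mul, norm_mul, norm_mul, norm_pow, Real.norm_of_nonneg hs.le,
        Real.norm_eq_abs (u z.2)]
      calc _ ≤ |u z.2| * (s ^ finrank ℝ E * (C * (K * (1 + ‖z.2‖) ^ (-p)))) * ‖ψ z.1‖ := by
            gcongr
            exact (hMC _).trans (by
              gcongr; exact one_add_norm_smul_sub_rpow_le hp hs hR0.le le_rfl hz1 _)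
        _ = _ := by ring

theorem tendsto_integral_mollify_mul (hp : (finrank ℝ E : ℝ) < p) (hum : AEStronglyMeasurable u)
    (hu : Integrable fun y => |u y| * (1 + ‖y‖) ^ (-p)) (hM : Continuous M)
    {C : ℝ} (hMC : ∀ x, ‖M x‖ ≤ C * (1 + ‖x‖) ^ (-p)) {ψ : E → ℝ} (hψ : Continuous ψ)
    (hψs : HasCompactSupport ψ) :
    Tendsto (fun s => ∫ x, mollify M u s x * ψ x) atTop (𝓝 ((∫ x, M x) * ∫ x, u x * ψ x)) := by
  have hp0 : 0 ≤ p := (Nat.cast_nonneg _).trans hp.le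
  have hC0 : 0 ≤ C := by
    have := (norm_nonneg _).trans (hMC 0)
    simpa using this
  have hMi : Integrable M := ((integrable_one_add_norm hp).const_mul C).mono'
    hM.aestronglyMeasurable (Eventually.of_forall hMC)
  have hψi := hψ.integrable_of_hasCompactSupport hψs (μ := volume)
  obtain ⟨R, hR0, hR⟩ := hψs.isCompact.isBounded.subset_closedBall_lt 0 0
  obtain ⟨A, hA⟩ := hψs.exists_bound_of_continuous hψ
  have hA0 : 0 ≤ A := (norm_nonneg _).trans (hA 0)
  have hpt : ∀ y, Tendsto (fun s : ℝ => u y * ∫ z, M z * ψ (y + s⁻¹ • z)) atTop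
      (𝓝 (u y * ∫ z, M z * ψ y)) := by
    intro y
    refine Tendsto.const_mul _ (tendsto_integral_filter_of_dominated_convergence
      (fun z => ‖M z‖ * A) (Eventually.of_forall fun s => ?_) (Eventually.of_forall fun s =>
        Eventually.of_forall fun z => ?_) (hMi.norm.mul_const A) (Eventually.of_forall fun z => ?_))
    · exact Continuous.aestronglyMeasurable (by fun_prop)
    · rw [norm_mul]
      gcongr
      exact hA _
    · refine Tendsto.const_mul _ ((hψ.tendsto y).comp ?_)
      have := (tendsto_inv_atTop_zero (𝕜 := ℝ)).smul_const z
      simpa using this.const_add y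
  have hbd : ∃ B : ℝ, ∀ s : ℝ, 1 ≤ s → ∀ y, ‖∫ z, M z * ψ (y + s⁻¹ • z)‖ ≤ B * (1 + ‖y‖) ^ (-p) := by
    refine ⟨_, fun s hs y => le_one_add_rpow_of_le (norm_nonneg y) hp0
      (A := (∫ z, ‖M z‖) * A) (B := C * 2 ^ p * ∫ x, ‖ψ x‖) (R := 2 * R + 1) ?_
      (mul_nonneg (integral_nonneg fun z => norm_nonneg _) hA0)
      (mul_nonneg (by positivity) (integral_nonneg fun z => norm_nonneg _)) (by linarith) ?_⟩
    · rw [← integral_mul_const]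
      refine norm_integral_le_of_norm_le (hMi.norm.mul_const A) (Eventually.of_forall fun z => ?_)
      rw [norm_mul]
      gcongr
      exact hA _
    · intro hy
      have hs0 : 0 < s := by linarith
      have hy0 : 0 < ‖y‖ := by linarith
      have h1 := Measure.integral_comp_smul volume (fun z => M z * ψ (y + s⁻¹ • z)) s
      rw [← integral_sub_right_eq_self _ y, abs_of_nonneg (by positivity),
        eq_inv_smul_iff₀ (by positivity), smul_eq_mul, ← integral_const_mul] at h1
      rw [← h1]
      have h2 : C * 2 ^ p * (∫ x, ‖ψ x‖) * ‖y‖ ^ (-p) =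
          ∫ x, C * 2 ^ p * ‖y‖ ^ (-p) * ‖ψ x‖ := by
        rw [integral_const_mul]; ring
      rw [h2]
      refine norm_integral_le_of_norm_le (hψi.norm.const_mul _) (Eventually.of_forall fun x => ?_)
      rw [smul_smul, inv_mul_cancel₀ hs0.ne', one_smul, add_sub_cancel, norm_mul, norm_mul,
        ← mul_assoc]
      by_cases hx : ψ x = 0
      · simp [hx]
      · have hx1 : ‖x‖ ≤ R := mem_closedBall_zero_iff.1 (hR (subset_tsupport ψ hx))
        refine mul_le_mul_of_nonneg_right ?_ (norm_nonneg _)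
        have h3 : ‖y‖ / 2 ≤ ‖x - y‖ := by
          have := norm_sub_norm_le y x
          rw [norm_sub_rev] at this
          linarith
        have h4 : (1 + ‖s • (x - y)‖) ^ (-p) ≤ s ^ (-p) * (2 ^ p * ‖y‖ ^ (-p)) := by
          calc (1 + ‖s • (x - y)‖) ^ (-p) ≤ (s * (‖y‖ / 2)) ^ (-p) := by
                refine rpow_le_rpow_of_nonpos (by positivity) ?_ (by linarith)
                rw [norm_smul, Real.norm_of_nonneg hs0.le]
                nlinarith
            _ = _ := by
              rw [mul_rpow hs0.le (by positivity), div_rpow hy0.le zero_le_two,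
                rpow_neg zero_le_two, div_inv_eq_mul, mul_comm (2 ^ p)]
        have h5 : s ^ finrank ℝ E * s ^ (-p) ≤ 1 := by
          rw [← rpow_natCast, ← rpow_add hs0]
          exact rpow_le_one_of_one_le_of_nonpos hs (by linarith)
        rw [norm_pow, Real.norm_of_nonneg hs0.le]
        calc s ^ finrank ℝ E * ‖M (s • (x - y))‖ ≤
              s ^ finrank ℝ E * (C * (s ^ (-p) * (2 ^ p * ‖y‖ ^ (-p)))) := by
              gcongr
              exact (hMC _).trans (by gcongr)
          _ = (s ^ finrank ℝ E * s ^ (-p)) * (C * (2 ^ p * ‖y‖ ^ (-p))) := by ring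
          _ ≤ 1 * (C * (2 ^ p * ‖y‖ ^ (-p))) := by gcongr
          _ = _ := by ring
  obtain ⟨B, hB⟩ := hbd
  have hlim := tendsto_integral_filter_of_dominated_convergence
    (μ := (volume : Measure E)) (F := fun (s : ℝ) y => u y * ∫ z, M z * ψ (y + s⁻¹ • z))
    (f := fun y => u y * ∫ z, M z * ψ y) (l := atTop)
    (fun y => B * (|u y| * (1 + ‖y‖) ^ (-p))) (Eventually.of_forall fun s => ?_) ?_
    (hu.const_mul B) (Eventually.of_forall hpt)
  · have h6 : ∫ y, u y * ∫ z, M z * ψ y = (∫ x, M x) * ∫ x, u x * ψ x := by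
      rw [← integral_const_mul]
      congr 1 with y
      rw [integral_mul_const]
      ring
    rw [h6] at hlim
    refine hlim.congr' ?_
    filter_upwards [eventually_gt_atTop 0] with s hs
    exact (integral_mollify_mul hp0 hum hu hM hMC hψ hψs hs).symm
  · have : StronglyMeasurable (Function.uncurry fun (y z : E) => M z * ψ (y + s⁻¹ • z)) :=
      Continuous.stronglyMeasurable (by simp only [Function.uncurry_def]; fun_prop)
    exact hum.mul this.integral_prod_right.aestronglyMeasurable
  · filter_upwards [eventually_ge_atTop 1] with s hs
    refine Eventually.of_forall fun y => ?_
    rw [norm_mul, Real.norm_eq_abs]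
    calc _ ≤ |u y| * (B * (1 + ‖y‖) ^ (-p)) := by gcongr; exact hB s hs y
      _ = _ := by ring

end Mollification

section Estimate

variable {E : Type*} [NormedAddCommGroup E] [InnerProductSpace ℝ E] [FiniteDimensional ℝ E]
  [MeasurableSpace E] [BorelSpace E] {p : ℝ} {u M : E → ℝ}

theorem integrableOn_compl_ball_mul_rpow (hp : 0 ≤ p) (hum : AEStronglyMeasurable u)
    (hu : Integrable fun y => |u y| * (1 + ‖y‖) ^ (-p)) {ρ : ℝ} (hρ : 0 < ρ) :
    IntegrableOn (fun y => |u y| * ‖y‖ ^ (-p)) (Metric.ball (0 : E) ρ)ᶜ := by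
  refine ((hu.const_mul ((ρ⁻¹ + 1) ^ p)).integrableOn).mono'
    (hum.norm.mul (by fun_prop : Measurable fun y : E => ‖y‖ ^ (-p)).aestronglyMeasurable).restrict
    ((ae_restrict_iff' measurableSet_ball.compl).2 (Eventually.of_forall fun y hy => ?_))
  have hy1 : ρ ≤ ‖y‖ := by simpa using hy
  have hy0 : 0 < ‖y‖ := hρ.trans_le hy1
  have h1 : 1 + ‖y‖ ≤ (ρ⁻¹ + 1) * ‖y‖ := by
    have : 1 ≤ ρ⁻¹ * ‖y‖ := by rwa [inv_mul_eq_div, one_le_div hρ]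
    linarith
  have h2 : ‖y‖ ^ (-p) ≤ (ρ⁻¹ + 1) ^ p * (1 + ‖y‖) ^ (-p) := by
    have h3 := rpow_le_rpow_of_nonpos (by positivity) h1 (by linarith : -p ≤ 0)
    rw [mul_rpow (by positivity) hy0.le] at h3
    calc ‖y‖ ^ (-p) = (ρ⁻¹ + 1) ^ p * ((ρ⁻¹ + 1) ^ (-p) * ‖y‖ ^ (-p)) := by
          rw [← mul_assoc, ← rpow_add (by positivity), add_neg_cancel, rpow_zero, one_mul]
      _ ≤ _ := by gcongr
  rw [Real.norm_of_nonneg (by positivity)]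
  calc _ ≤ |u y| * ((ρ⁻¹ + 1) ^ p * (1 + ‖y‖) ^ (-p)) := by gcongr
    _ = _ := by ring

theorem norm_iteratedFDeriv_mollify_le (hp : 0 ≤ p) (hul : LocallyIntegrable u)
    (hu : Integrable fun y => |u y| * (1 + ‖y‖) ^ (-p)) (hM : ContDiff ℝ (⊤ : ℕ∞) M)
    (hMk : ∀ k : ℕ, ∃ C : ℝ, 0 ≤ C ∧ ∀ x, ‖iteratedFDeriv ℝ k M x‖ ≤ C * (1 + ‖x‖) ^ (-p))
    {k : ℕ} {C : ℝ} (hC0 : 0 ≤ C) (hC : ∀ x, ‖iteratedFDeriv ℝ k M x‖ ≤ C * (1 + ‖x‖) ^ (-p))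
    {r : ℝ} (hr : 0 < r) {x : E} (hx : ‖x‖ < r) :
    ‖iteratedFDeriv ℝ k (mollify M u (2 / r)) x‖ ≤ C * (2 / r) ^ (finrank ℝ E + k) *
      (r ^ p * (∫ y in (Metric.ball (0 : E) (2 * r))ᶜ, |u y| * ‖y‖ ^ (-p)) +
        ∫ y in Metric.ball (0 : E) (2 * r), |u y|) := by
  have hum := hul.aestronglyMeasurable
  have hs : 0 < 2 / r := by positivity
  have hser := hasFTaylorSeriesUpTo_mollify hp hum hu hM hMk hs
  rw [← hser.eq_iteratedFDeriv (by exact_mod_cast le_top)]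
  have hB : MeasurableSet (Metric.ball (0 : E) (2 * r)) := measurableSet_ball
  have hi1 := integrableOn_compl_ball_mul_rpow hp hum hu (by positivity : 0 < 2 * r)
  have hi2 : IntegrableOn (fun y => |u y|) (Metric.ball (0 : E) (2 * r)) :=
    ((hul.integrableOn_isCompact (isCompact_closedBall 0 (2 * r))).mono_set
      Metric.ball_subset_closedBall).norm
  have hi1' := ((integrable_indicator_iff hB.compl).2 hi1).const_mul (r ^ p)
  have hi2' := (integrable_indicator_iff hB).2 hi2
  rw [← integral_indicator hB, ← integral_indicator hB.compl, ← integral_const_mul,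
    ← integral_add hi1' hi2', ← integral_const_mul]
  refine norm_integral_le_of_norm_le ((hi1'.add hi2').const_mul _)
    (Eventually.of_forall fun y => ?_)
  rw [norm_smul, norm_mul, norm_pow, Real.norm_of_nonneg hs.le, Real.norm_eq_abs]
  have key : (1 + ‖(2 / r) • (x - y)‖) ^ (-p) * |u y| ≤
      r ^ p * (Metric.ball (0 : E) (2 * r))ᶜ.indicator (fun y => |u y| * ‖y‖ ^ (-p)) y +
        (Metric.ball (0 : E) (2 * r)).indicator (fun y => |u y|) y := by
    by_cases hy : y ∈ Metric.ball (0 : E) (2 * r)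
    · rw [Set.indicator_of_mem hy, Set.indicator_of_notMem (by simpa using hy), mul_zero, zero_add]
      exact mul_le_of_le_one_left (abs_nonneg _)
        (rpow_le_one_of_one_le_of_nonpos (by linarith [norm_nonneg ((2 / r) • (x - y))])
          (by linarith))
    · rw [Set.indicator_of_notMem hy, Set.indicator_of_mem (by simpa using hy), add_zero]
      have hy1 : 2 * r ≤ ‖y‖ := by simpa using hy
      have hy0 : 0 < ‖y‖ := by linarith
      have h1 : ‖y‖ / 2 ≤ ‖x - y‖ := by
        have := norm_sub_norm_le y x
        rw [norm_sub_rev] at this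
        linarith
      have h2 : r⁻¹ * ‖y‖ ≤ 1 + ‖(2 / r) • (x - y)‖ := by
        rw [norm_smul, Real.norm_of_nonneg hs.le]
        have h3 : 2 / r * (‖y‖ / 2) ≤ 2 / r * ‖x - y‖ := by gcongr
        have h4 : 2 / r * (‖y‖ / 2) = r⁻¹ * ‖y‖ := by field_simp
        linarith
      have h5 := rpow_le_rpow_of_nonpos (by positivity) h2 (by linarith : -p ≤ 0)
      rw [mul_rpow (by positivity) hy0.le, inv_rpow hr.le, rpow_neg hr.le, inv_inv] at h5
      calc _ ≤ r ^ p * ‖y‖ ^ (-p) * |u y| := by gcongr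
        _ = _ := by ring
  calc _ ≤ |u y| * (2 / r) ^ (finrank ℝ E + k) * (C * (1 + ‖(2 / r) • (x - y)‖) ^ (-p)) := by
        gcongr
        exact hC _
    _ = C * (2 / r) ^ (finrank ℝ E + k) * ((1 + ‖(2 / r) • (x - y)‖) ^ (-p) * |u y|) := by ring
    _ ≤ _ := by gcongr

end Estimate

theorem fracConst_pos (n : ℕ) {σ : ℝ} (hσ : σ ∈ Set.Ioo (0 : ℝ) 1) : 0 < fracConst n σ := by
  obtain ⟨h0, h1⟩ := hσ
  have hΓ : Real.Gamma (-σ) ≠ 0 := Real.Gamma_ne_zero fun m hm => by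
    have h2 : σ = m := by linarith
    rw [h2] at h0 h1
    have h3 : 0 < m := by exact_mod_cast h0
    have h4 : m < 1 := by exact_mod_cast h1
    omega
  have hΓ' : 0 < Real.Gamma ((n : ℝ) / 2 + σ) := Real.Gamma_pos_of_pos (by positivity)
  unfold fracConst
  have := abs_pos.2 hΓ
  positivity

theorem integral_mul_nonlocalOp_eq_zero {n : ℕ} (hn : 1 ≤ n) {σ : ℝ}
    (hσ : σ ∈ Set.Ioo (0 : ℝ) 1) {R : ℝ} {u g : EuclideanSpace ℝ (Fin n) → ℝ}
    (hu : ∀ φ : EuclideanSpace ℝ (Fin n) → ℝ, ContDiff ℝ (⊤ : ℕ∞) φ → HasCompactSupport φ →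
      tsupport φ ⊆ Metric.ball 0 R → ∫ x, u x * fracLap n σ φ x = 0)
    (hg : ContDiff ℝ (⊤ : ℕ∞) g) (hs : tsupport g ⊆ Metric.closedBall 0 1)
    {x : EuclideanSpace ℝ (Fin n)} {τ : ℝ} (hτ : 0 < τ) (hx : ‖x‖ + τ⁻¹ < R) :
    ∫ y, u y * nonlocalOp ((n : ℝ) + 2 * σ) g (τ • (y - x)) = 0 := by
  set φ : EuclideanSpace ℝ (Fin n) → ℝ := fun z => g (τ • (z - x)) with hφ
  have hφs : tsupport φ ⊆ Metric.closedBall x τ⁻¹ := by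
    refine closure_minimal (fun z hz => ?_) Metric.isClosed_closedBall
    have := mem_closedBall_zero_iff.1 (hs (subset_tsupport g hz))
    rw [norm_smul, Real.norm_of_nonneg hτ.le] at this
    rw [mem_closedBall_iff_norm, ← one_div, le_div_iff₀' hτ]
    exact this
  have hφc : HasCompactSupport φ := HasCompactSupport.of_support_subset_isCompact
    (isCompact_closedBall x τ⁻¹) ((subset_tsupport φ).trans hφs)
  have hφd : ContDiff ℝ (⊤ : ℕ∞) φ :=
    hg.comp ((contDiff_const_smul τ).comp (contDiff_id.sub contDiff_const))
  have h := hu φ hφd hφc (hφs.trans fun z hz => by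
    rw [mem_closedBall_iff_norm] at hz
    rw [mem_ball_zero_iff]
    have := norm_sub_norm_le z x
    linarith)
  have h1 : ∀ y, u y * fracLap n σ φ y = fracConst n σ *
      τ ^ ((n : ℝ) + 2 * σ - finrank ℝ (EuclideanSpace ℝ (Fin n))) *
        (u y * nonlocalOp ((n : ℝ) + 2 * σ) g (τ • (y - x))) := fun y => by
    rw [fracLap_eq_nonlocalOp hn hσ (contDiff_infty.1 hφd 2) hφc, hφ,
      nonlocalOp_comp_smul_sub _ _ hτ, smul_eq_mul]
    ring
  simp only [h1] at h
  rw [integral_const_mul] at h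
  exact (mul_eq_zero.1 h).resolve_left
    (mul_pos (fracConst_pos n hσ) (rpow_pos_of_pos hτ _)).ne'

/-- Theorem 17 (interior estimates for σ-harmonic functions): if `u ∈ L_σ(ℝⁿ)` and
`(−Δ)^σ u = 0` in `B_{2r}(0)`, then `u` is smooth in `B_{2r}(0)` and for every `k` the
`k`-th derivatives on `B_r` are bounded by
`(C/r^k)(r^{2σ}∫_{ℝⁿ∖B_{2r}} |u|/|x|^{n+2σ} + r^{−n}∫_{B_{2r}} |u|)`, with `C = C(n,σ,k)`
independent of `u` and `r`. -/
theorem interior_estimates_sigma_harmonic (n : ℕ) (hn : 1 ≤ n) (σ : ℝ)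
    (hσ : σ ∈ Set.Ioo (0 : ℝ) 1) (k : ℕ) :
    ∃ C : ℝ, 0 < C ∧ ∀ r : ℝ, 0 < r → ∀ u : EuclideanSpace ℝ (Fin n) → ℝ,
      MemLσ n σ u →
      (∀ φ : EuclideanSpace ℝ (Fin n) → ℝ, ContDiff ℝ (⊤ : ℕ∞) φ → HasCompactSupport φ →
          tsupport φ ⊆ Metric.ball 0 (2 * r) →
          ∫ x, u x * fracLap n σ φ x = 0) →
      ∃ v : EuclideanSpace ℝ (Fin n) → ℝ,
        ContDiffOn ℝ (⊤ : ℕ∞) v (Metric.ball 0 (2 * r)) ∧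
        (∀ᵐ x : EuclideanSpace ℝ (Fin n), x ∈ Metric.ball 0 (2 * r) → u x = v x) ∧
        ∀ x ∈ Metric.ball (0 : EuclideanSpace ℝ (Fin n)) r,
          ‖iteratedFDeriv ℝ k v x‖ ≤ C / r ^ k *
            (r ^ (2 * σ) *
                (∫ y in (Metric.ball (0 : EuclideanSpace ℝ (Fin n)) (2 * r))ᶜ,
                  |u y| / ‖y‖ ^ ((n : ℝ) + 2 * σ)) +
              r ^ (-(n : ℝ)) *
                ∫ y in Metric.ball (0 : EuclideanSpace ℝ (Fin n)) (2 * r), |u y|) := by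
  have : NeZero n := ⟨by omega⟩
  set p : ℝ := (n : ℝ) + 2 * σ with hpdef
  have hfin : finrank ℝ (EuclideanSpace ℝ (Fin n)) = n := finrank_euclideanSpace_fin
  have hp : (finrank ℝ (EuclideanSpace ℝ (Fin n)) : ℝ) < p := by rw [hfin]; linarith [hσ.1]
  have hp' : p < finrank ℝ (EuclideanSpace ℝ (Fin n)) + 2 := by rw [hfin]; linarith [hσ.2]
  have hp0 : 0 ≤ p := (Nat.cast_nonneg _).trans hp.le
  obtain ⟨g, M, hg, hgs, hHe, hM, hMk, hMi, hMH⟩ :=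
    exists_mollifier_of_nonlocalOp (EuclideanSpace ℝ (Fin n)) hp hp'
  set c := ∫ x, M x with hc
  set H := nonlocalOp p g with hH
  have hgc : HasCompactSupport g := HasCompactSupport.of_support_subset_isCompact
    (isCompact_closedBall 0 1) ((subset_tsupport g).trans hgs)
  have hHc : Continuous H :=
    (hasFTaylorSeriesUpTo_nonlocalOp hp hp' hg hgc).contDiff.continuous
  obtain ⟨C₁, -, hC₁⟩ := exists_norm_nonlocalOp_le hp hp' (contDiff_infty.1 hg 2) hgs
  obtain ⟨C₂, -, hC₂⟩ := hMk 0
  simp only [norm_iteratedFDeriv_zero] at hC₂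
  have hHC : ∀ x, ‖H x‖ ≤ max C₁ C₂ * (1 + ‖x‖) ^ (-p) := fun x =>
    (hC₁ x).trans (by gcongr; exact le_max_left _ _)
  have hMC : ∀ x, ‖M x‖ ≤ max C₁ C₂ * (1 + ‖x‖) ^ (-p) := fun x =>
    (hC₂ x).trans (by gcongr; exact le_max_right _ _)
  obtain ⟨C, hC0, hC⟩ := hMk k
  refine ⟨|c|⁻¹ * (C * 2 ^ (n + k)) + 1, by positivity, fun r hr u ⟨hul, hui⟩ hzero => ?_⟩
  have hum := hul.aestronglyMeasurable
  have hu : Integrable fun y => |u y| * (1 + ‖y‖) ^ (-p) := by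
    refine (hui.const_mul 2).mono' (hum.norm.mul (by fun_prop : Measurable
      fun y : EuclideanSpace ℝ (Fin n) => (1 + ‖y‖) ^ (-p)).aestronglyMeasurable)
      (Eventually.of_forall fun y => ?_)
    have h1 : ‖y‖ ^ p ≤ (1 + ‖y‖) ^ p := by gcongr; linarith
    have h2 : 1 ≤ (1 + ‖y‖) ^ p := one_le_rpow (by linarith [norm_nonneg y]) hp0
    rw [Real.norm_of_nonneg (by positivity), rpow_neg (by positivity), ← div_eq_mul_inv,
      ← mul_div_assoc, div_le_div_iff₀ (by positivity) (by positivity)]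
    nlinarith [abs_nonneg (u y)]
  have hz : ∀ x : EuclideanSpace ℝ (Fin n), ∀ ρ < 2 * r, ‖x‖ ≤ ρ → ∀ τ, 2 / (2 * r - ρ) ≤ τ →
      ∫ y, u y * H (τ • (x - y)) = 0 := by
    intro x ρ hρ hx τ hτ
    have hpos : 0 < 2 * r - ρ := by linarith
    have hτ0 : 0 < τ := lt_of_lt_of_le (by positivity) hτ
    have hinv : τ⁻¹ ≤ (2 * r - ρ) / 2 := by
      rw [← inv_div]
      exact inv_anti₀ (by positivity) hτ
    have h := integral_mul_nonlocalOp_eq_zero hn hσ hzero hg hgs (x := x) hτ0 (by linarith)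
    rw [← h]
    congr 1 with y
    rw [← hHe (τ • (x - y)), ← smul_neg, neg_sub]
  set v : EuclideanSpace ℝ (Fin n) → ℝ :=
    fun x => c⁻¹ * mollify M u (2 / (2 * r - ‖x‖)) x with hv
  have hvs : ∀ ρ < 2 * r, ∀ s, 2 / (2 * r - ρ) ≤ s → ∀ x : EuclideanSpace ℝ (Fin n), ‖x‖ ≤ ρ →
      v x = c⁻¹ * mollify M u s x := by
    intro ρ hρ s hs x hx
    have hpos : 0 < 2 * r - ρ := by linarith
    have hpos' : 0 < 2 * r - ‖x‖ := by linarith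
    simp only [hv]
    rw [mollify_eq_mollify hp0 hum hu hHc hM.continuous hHC hMC hMH
      (by positivity : 0 < 2 / (2 * r - ‖x‖)) ((by gcongr : _ ≤ 2 / (2 * r - ρ)).trans hs)
      (hz x ‖x‖ (hx.trans_lt hρ) le_rfl)]
  have hVd : ∀ s, 0 < s → ContDiff ℝ (⊤ : ℕ∞) (mollify M u s) := fun s hs =>
    (hasFTaylorSeriesUpTo_mollify hp0 hum hu hM hMk hs).contDiff
  have hvd : ContDiffOn ℝ (⊤ : ℕ∞) v (Metric.ball 0 (2 * r)) := by
    intro x hx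
    rw [mem_ball_zero_iff] at hx
    obtain ⟨ρ, hxρ, hρ⟩ := exists_between hx
    have hpos : 0 < 2 * r - ρ := by linarith
    have hev : v =ᶠ[𝓝 x] fun x => c⁻¹ * mollify M u (2 / (2 * r - ρ)) x := by
      filter_upwards [continuous_norm.continuousAt.eventually_lt continuousAt_const hxρ] with y hy
      exact hvs ρ hρ _ le_rfl y hy.le
    exact ((contDiff_const.mul (hVd _ (by positivity))).contDiffAt.congr_of_eventuallyEq
      hev).contDiffWithinAt
  refine ⟨v, hvd, ?_, fun x hx => ?_⟩
  · have hae := Metric.isOpen_ball.ae_eq_zero_of_integral_contDiff_smul_eq_zero (μ := volume)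
      (f := fun x => u x - v x) (U := Metric.ball (0 : EuclideanSpace ℝ (Fin n)) (2 * r))
      ((hul.locallyIntegrableOn _).sub
        (hvd.continuousOn.locallyIntegrableOn measurableSet_ball)) fun ψ hψ hψc hψs => ?_
    · filter_upwards [hae] with x hx hxb
      exact sub_eq_zero.1 (hx hxb)
    · obtain ⟨ρ, hρ, hρs⟩ := exists_lt_subset_ball (isClosed_tsupport ψ) hψs
      have hpos : 0 < 2 * r - ρ := by linarith
      have heq : ∀ s, 2 / (2 * r - ρ) ≤ s →
          ∀ x, ψ x * v x = c⁻¹ * (mollify M u s x * ψ x) := by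
        intro s hs x
        by_cases hx : ψ x = 0
        · simp [hx]
        · rw [hvs ρ hρ s hs x (mem_ball_zero_iff.1 (hρs (subset_tsupport ψ hx))).le]
          ring
      have hlim := (tendsto_integral_mollify_mul hp hum hu hM.continuous hMC hψ.continuous
        hψc).const_mul c⁻¹
      rw [← mul_assoc, inv_mul_cancel₀ hMi, one_mul] at hlim
      have hconst : ∫ x, ψ x * v x = ∫ x, u x * ψ x := by
        refine tendsto_nhds_unique (tendsto_const_nhds.congr' ?_) hlim
        filter_upwards [eventually_ge_atTop (2 / (2 * r - ρ))] with s hs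
        rw [← integral_const_mul]
        exact integral_congr_ae (Eventually.of_forall (heq s hs))
      have hi1 : Integrable fun x => ψ x * u x :=
        hul.integrable_smul_left_of_hasCompactSupport hψ.continuous hψc
      have hi2 : Integrable fun x => ψ x * v x := by
        simp only [heq _ le_rfl]
        refine Integrable.const_mul ?_ _
        exact ((hVd _ (by positivity)).continuous.mul
          hψ.continuous).integrable_of_hasCompactSupport hψc.mul_left
      simp only [smul_eq_mul, mul_sub]
      rw [integral_sub hi1 hi2, hconst, sub_eq_zero]
      simp only [mul_comm]
  · rw [mem_ball_zero_iff] at hx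
    have hev : v =ᶠ[𝓝 x] fun x => c⁻¹ • mollify M u (2 / r) x := by
      filter_upwards [continuous_norm.continuousAt.eventually_lt continuousAt_const hx] with y hy
      exact hvs r (by linarith) _ (by rw [two_mul, add_sub_cancel_right]) y hy.le
    rw [(hev.iteratedFDeriv ℝ k).eq_of_nhds, iteratedFDeriv_const_smul_apply'
      (contDiff_infty.1 (hVd (2 / r) (by positivity)) k).contDiffAt, norm_smul, norm_inv,
      Real.norm_eq_abs]
    have hmain := norm_iteratedFDeriv_mollify_le hp0 hul hu hM hMk hC0 hC hr hx
    rw [hfin] at hmain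
    have hI : ∫ y in (Metric.ball (0 : EuclideanSpace ℝ (Fin n)) (2 * r))ᶜ, |u y| * ‖y‖ ^ (-p) =
        ∫ y in (Metric.ball (0 : EuclideanSpace ℝ (Fin n)) (2 * r))ᶜ, |u y| / ‖y‖ ^ p := by
      congr 1 with y
      rw [rpow_neg (norm_nonneg _), div_eq_mul_inv]
    rw [hI] at hmain
    set I := ∫ y in (Metric.ball (0 : EuclideanSpace ℝ (Fin n)) (2 * r))ᶜ, |u y| / ‖y‖ ^ p
    set J := ∫ y in Metric.ball (0 : EuclideanSpace ℝ (Fin n)) (2 * r), |u y|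
    have hI0 : 0 ≤ I := integral_nonneg fun y => by positivity
    have hJ0 : 0 ≤ J := integral_nonneg fun y => abs_nonneg _
    have hrp : r ^ p = r ^ n * r ^ (2 * σ) := by rw [hpdef, rpow_add hr, rpow_natCast]
    have hrn : r ^ (-(n : ℝ)) = (r ^ n)⁻¹ := by rw [rpow_neg hr.le, rpow_natCast]
    have hT : 0 ≤ 1 / r ^ k * (r ^ (2 * σ) * I + r ^ (-(n : ℝ)) * J) := by positivity
    calc |c|⁻¹ * ‖iteratedFDeriv ℝ k (mollify M u (2 / r)) x‖
        ≤ |c|⁻¹ * (C * (2 / r) ^ (n + k) * (r ^ p * I + J)) := by gcongr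
      _ = |c|⁻¹ * (C * 2 ^ (n + k)) * (1 / r ^ k * (r ^ (2 * σ) * I + r ^ (-(n : ℝ)) * J)) := by
        rw [hrp, hrn, div_pow, pow_add r]
        field_simp
      _ ≤ (|c|⁻¹ * (C * 2 ^ (n + k)) + 1) *
          (1 / r ^ k * (r ^ (2 * σ) * I + r ^ (-(n : ℝ)) * J)) := by gcongr; linarith
      _ = _ := by ring
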